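/- arXiv:2002.04702 — 2 statements merged into one kernel-verified Lean document; each statement's English description precedes it below -/
import Mathlib

section
/- Let k ≥ 1 be an integer and let 𝒢_1, …, 𝒢_k be nonempty families of connected finite simple graphs with minimum degrees d_1, …, d_k respectively, where d_i = min{δ(G) : G ∈ 𝒢_i} and each d_i ≥ 1. Let H be a connected finite simple graph with maximum degree Δ(H) = d_1 + ⋯ + d_k. Assume: (i) if k = 1 then H is not isomorphic to any member of 𝒢_1; (ii) if K_{d_i+1} ∈ 𝒢_i for every 1 ≤ i ≤ k, then H is not isomorphic to K_{Δ(H)+1}; (iii) if K_2 ∈ 𝒢_i for every 1 ≤ i ≤ k, then H is neither an odd cycle nor a complete graph. Then there is a partition of V(H) into sets V_1, …, V_k such that the induced subgraph H[V_i] is 𝒢_i-free for every i, and moreover V_1 can be chosen to be a maximum 𝒢_1-free subset of V(H). -/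
open SimpleGraph

/-- `H` contains a subgraph isomorphic to `G`, i.e. there is an injective graph
homomorphism from `G` to `H`. -/
def HasCopy {α β : Type*} (G : SimpleGraph α) (H : SimpleGraph β) : Prop :=
  ∃ f : G →g H, Function.Injective f

/-- `H` is isomorphic to an odd cycle (a cycle on an odd number `≥ 3` of vertices). -/
def IsOddCycle {β : Type*} (H : SimpleGraph β) : Prop :=
  ∃ n : ℕ, Odd n ∧ 3 ≤ n ∧ Nonempty (H ≃g cycleGraph n)

section Components

variable {V : Type*} (H : SimpleGraph V)

open scoped Classical in
/-- The neighbours of `v` inside the finite set `T`. -/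
noncomputable def nbrsIn (T : Finset V) (v : V) : Finset V := T.filter (H.Adj v)

/-- `X` is closed under passing to neighbours inside `T`. -/
def ClosedIn (X T : Finset V) : Prop := ∀ x ∈ X, ∀ y ∈ T, H.Adj x y → y ∈ X

/-- `B` is nonempty and induces a connected subgraph, phrased through closed subsets. -/
def ConnectedSet (B : Finset V) : Prop :=
  B.Nonempty ∧ ∀ X ⊆ B, X.Nonempty → ClosedIn H X B → X = B

variable {H}

@[simp] theorem mem_nbrsIn {T : Finset V} {v w : V} :
    w ∈ nbrsIn H T v ↔ w ∈ T ∧ H.Adj v w := by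
  simp [nbrsIn]

theorem nbrsIn_mono {S T : Finset V} (h : S ⊆ T) (v : V) : nbrsIn H S v ⊆ nbrsIn H T v := by
  intro w hw
  rw [mem_nbrsIn] at hw ⊢
  exact ⟨h hw.1, hw.2⟩

theorem nbrsIn_eq_of_closedIn {X T : Finset V} (hX : X ⊆ T) (hc : ClosedIn H X T) {x : V}
    (hx : x ∈ X) : nbrsIn H X x = nbrsIn H T x := by
  ext w
  simp only [mem_nbrsIn]
  exact ⟨fun h => ⟨hX h.1, h.2⟩, fun h => ⟨hc x hx w h.1 h.2, h.2⟩⟩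

variable [DecidableEq V]

open scoped Classical in
theorem card_nbrsIn_insert {T : Finset V} {x : V} (hx : x ∉ T) (v : V) :
    (nbrsIn H (insert x T) v).card = (nbrsIn H T v).card + if H.Adj v x then 1 else 0 := by
  by_cases h : H.Adj v x
  · have : nbrsIn H (insert x T) v = insert x (nbrsIn H T v) := by
      ext w; simp only [mem_nbrsIn, Finset.mem_insert]; grind
    rw [this, Finset.card_insert_of_notMem (by simp [hx])]; simp [h]
  · have : nbrsIn H (insert x T) v = nbrsIn H T v := by
      ext w; simp only [mem_nbrsIn, Finset.mem_insert]; grind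
    rw [this]; simp [h]

theorem nbrsIn_erase_self (T : Finset V) (v : V) : nbrsIn H (T.erase v) v = nbrsIn H T v := by
  ext w
  simp only [mem_nbrsIn, Finset.mem_erase]
  exact ⟨fun h => ⟨h.1.2, h.2⟩, fun h => ⟨⟨h.2.ne', h.1⟩, h.2⟩⟩

theorem exists_component {T : Finset V} {u : V} (hu : u ∈ T) :
    ∃ B ⊆ T, u ∈ B ∧ ClosedIn H B T ∧ ConnectedSet H B := by
  classical
  let B := T.filter fun w => ∀ X ⊆ T, u ∈ X → ClosedIn H X T → w ∈ X
  have hmem : ∀ w, w ∈ B ↔ w ∈ T ∧ ∀ X ⊆ T, u ∈ X → ClosedIn H X T → w ∈ X := by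
    intro w; simp [B]
  have huB : u ∈ B := (hmem u).2 ⟨hu, fun X _ h _ => h⟩
  have hBc : ClosedIn H B T := fun x hx y hy hxy =>
    (hmem y).2 ⟨hy, fun X hX huX hc => hc x (((hmem x).1 hx).2 X hX huX hc) y hy hxy⟩
  refine ⟨B, Finset.filter_subset _ _, huB, hBc, ⟨u, huB⟩, ?_⟩
  intro X hXB hXn hXc
  by_cases huX : u ∈ X
  · refine hXB.antisymm fun w hw =>
      ((hmem w).1 hw).2 X (hXB.trans (Finset.filter_subset _ _)) huX ?_
    exact fun x hx y hy hxy => hXc x hx y (hBc x (hXB hx) y hy hxy) hxy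
  · obtain ⟨z, hz⟩ := hXn
    have := ((hmem z).1 (hXB hz)).2 (B \ X) (Finset.sdiff_subset.trans (Finset.filter_subset _ _))
      (by simp [huB, huX]) (by
        intro x hx y hy hxy
        rw [Finset.mem_sdiff] at hx ⊢
        exact ⟨hBc x hx.1 y hy hxy, fun hyX => hx.2 (hXc y hyX x hx.1 hxy.symm)⟩)
    exact absurd hz (Finset.mem_sdiff.1 this).2

theorem ConnectedSet.subset_of_closedIn {P B T : Finset V} (hP : ConnectedSet H P) (hPT : P ⊆ T)
    (hB : ClosedIn H B T) {p : V} (hp : p ∈ P) (hpB : p ∈ B) : P ⊆ B := by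
  have : P ∩ B = P := hP.2 _ Finset.inter_subset_left ⟨p, by simp [hp, hpB]⟩ (by
    intro x hx y hy hxy
    rw [Finset.mem_inter] at hx ⊢
    exact ⟨hy, hB x hx.2 y (hPT hy) hxy⟩)
  exact Finset.inter_eq_left.1 this

theorem connectedSet_of_center {B : Finset V} {u : V} (hu : u ∈ B)
    (h : ∀ x ∈ B, x ≠ u → H.Adj u x) : ConnectedSet H B := by
  refine ⟨⟨u, hu⟩, fun X hX ⟨z, hz⟩ hc => hX.antisymm fun w hw => ?_⟩
  have huX : u ∈ X := by
    by_cases hzu : z = u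
    · exact hzu ▸ hz
    · exact hc z hz u hu (h z (hX hz) hzu).symm
  by_cases hwu : w = u
  · exact hwu ▸ huX
  · exact hc u huX w hw (h w hw hwu)

theorem ConnectedSet.insert_of_adj {X : Finset V} (hX : ConnectedSet H X) {x w : V} (hx : x ∈ X)
    (hxw : H.Adj x w) : ConnectedSet H (insert w X) := by
  refine ⟨⟨w, by simp⟩, fun Y hY hYn hc => ?_⟩
  have key : x ∈ Y := by
    obtain ⟨z, hz⟩ := hYn
    rcases Finset.mem_insert.1 (hY hz) with rfl | hzX
    · exact hc z hz x (by simp [hx]) hxw.symm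
    · exact hX.subset_of_closedIn (Finset.subset_insert _ _) hc hzX hz hx
  refine hY.antisymm (Finset.insert_subset (hc x key w (by simp) hxw) ?_)
  exact hX.subset_of_closedIn (Finset.subset_insert _ _) hc hx key

theorem ConnectedSet.exists_adj_of_ssubset {B X : Finset V} (hB : ConnectedSet H B) (hX : X ⊂ B)
    (hXn : X.Nonempty) : ∃ x ∈ X, ∃ w ∈ B, w ∉ X ∧ H.Adj x w := by
  by_contra! hcon
  refine hX.ne (hB.2 X hX.1 hXn fun x hx y hy hxy => ?_)
  by_contra hyX
  exact hcon x hx y hy hyX hxy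

/-- A connected set with at least two elements has a non-cut vertex other than `u` which is not
adjacent to `u`, unless `u` is adjacent to all of the set. -/
theorem ConnectedSet.exists_connectedSet_erase {B : Finset V} (hB : ConnectedSet H B) {u z : V}
    (hu : u ∈ B) (hz : z ∈ B) (hzu : z ≠ u) :
    ∃ w ∈ B, w ≠ u ∧ ConnectedSet H (B.erase w) ∧
      (H.Adj u w → ∀ x ∈ B, x ≠ u → H.Adj u x) := by
  classical
  by_cases hall : ∀ x ∈ B, x ≠ u → H.Adj u x
  · refine ⟨z, hz, hzu, connectedSet_of_center (u := u) (by simp [hu, hzu.symm]) ?_, fun _ => hall⟩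
    exact fun x hx hxu => hall x (Finset.mem_of_mem_erase hx) hxu
  · let F := B.powerset.filter fun X => X ≠ B ∧ ConnectedSet H X ∧ insert u (nbrsIn H B u) ⊆ X
    have hF : ∀ X, X ∈ F ↔ X ⊆ B ∧ X ≠ B ∧ ConnectedSet H X ∧ insert u (nbrsIn H B u) ⊆ X := by
      intro X; simp [F]
    have hne : F.Nonempty := by
      refine ⟨insert u (nbrsIn H B u), (hF _).2 ⟨?_, ?_, ?_, subset_rfl⟩⟩
      · intro x hx
        rcases Finset.mem_insert.1 hx with rfl | hx
        · exact hu
        · exact (mem_nbrsIn.1 hx).1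
      · intro heq
        refine hall fun x hx hxu => ?_
        rw [← heq] at hx
        exact (mem_nbrsIn.1 ((Finset.mem_insert.1 hx).resolve_left hxu)).2
      · refine connectedSet_of_center (u := u) (by simp) fun x hx hxu => ?_
        exact (mem_nbrsIn.1 ((Finset.mem_insert.1 hx).resolve_left hxu)).2
    obtain ⟨X, hXF, hmax⟩ := F.exists_max_image Finset.card hne
    obtain ⟨hXB, hXne, hXc, hXu⟩ := (hF X).1 hXF
    obtain ⟨x, hx, w, hwB, hwX, hxw⟩ := hB.exists_adj_of_ssubset (hXB.ssubset_of_ne hXne) hXc.1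
    have heq : insert w X = B := by
      by_contra hcon
      have := hmax (insert w X) ((hF _).2 ⟨Finset.insert_subset hwB hXB, hcon,
        hXc.insert_of_adj hx hxw,
        hXu.trans (Finset.subset_insert _ _)⟩)
      rw [Finset.card_insert_of_notMem hwX] at this
      omega
    refine ⟨w, hwB, ?_, ?_, ?_⟩
    · rintro rfl; exact hwX (hXu (by simp))
    · rw [← heq, Finset.erase_insert hwX]; exact hXc
    · intro huw
      exact absurd (hXu (by simp [hwB, huw])) hwX

end Components

section Slides

variable {V : Type*} [DecidableEq V]

/-- A family of states: two disjoint sets `S false`, `S true` and a hole `u` outside of them with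
exactly `d b` neighbours in `S b`.  The hole may swap places with any of its neighbours. -/
structure SlideSystem (H : SimpleGraph V) (d : Bool → ℕ)
    (St : (Bool → Finset V) → V → Prop) : Prop where
  notMem : ∀ {S u}, St S u → ∀ b, u ∉ S b
  disj : ∀ {S u}, St S u → ∀ b, Disjoint (S b) (S !b)
  card_nbrsIn : ∀ {S u}, St S u → ∀ b, (nbrsIn H (S b) u).card = d b
  slide : ∀ {S u}, St S u → ∀ b, ∀ w ∈ S b, H.Adj u w →
    St (Function.update S b (insert u ((S b).erase w))) w

variable {H : SimpleGraph V} {d : Bool → ℕ} {St : (Bool → Finset V) → V → Prop}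

theorem SlideSystem.slide_component (hS : SlideSystem H d St) {S : Bool → Finset V} {u : V}
    (h : St S u) (b : Bool) {B : Finset V} (hB : B ⊆ insert u (S b)) (huB : u ∈ B)
    (hconn : ConnectedSet H B) {w : V} (hw : w ∈ B) :
    St (Function.update S b ((insert u (S b)).erase w)) w := by
  classical
  have key : B.filter (fun w => St (Function.update S b ((insert u (S b)).erase w)) w) = B := by
    refine hconn.2 _ (Finset.filter_subset _ _) ⟨u, ?_⟩ ?_
    · rw [Finset.mem_filter]
      refine ⟨huB, ?_⟩
      rw [Finset.erase_insert (hS.notMem h b), Function.update_eq_self]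
      exact h
    · intro x hx y hy hxy
      rw [Finset.mem_filter] at hx ⊢
      refine ⟨hy, ?_⟩
      have := hS.slide hx.2 b y (by simpa [hxy.ne'] using hB hy) hxy
      rw [Function.update_idem, Function.update_self] at this
      convert this using 2
      have h1 := hB hx.1
      have h2 := hxy.ne
      ext z
      simp only [Finset.mem_erase, Finset.mem_insert] at h1 ⊢
      grind
  rw [← key] at hw
  exact (Finset.mem_filter.1 hw).2

theorem SlideSystem.card_nbrsIn_component (hS : SlideSystem H d St) {S : Bool → Finset V} {u : V}
    (h : St S u) (b : Bool) {B : Finset V} (hB : B ⊆ insert u (S b)) (huB : u ∈ B)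
    (hconn : ConnectedSet H B) {w : V} (hw : w ∈ B) :
    (nbrsIn H (insert u (S b)) w).card = d b := by
  have := hS.card_nbrsIn (hS.slide_component h b hB huB hconn hw) b
  rwa [Function.update_self, nbrsIn_erase_self] at this

/-- If the hole `h` is adjacent to a connected part `P` of `S b` whose vertices have degree `d b`
after adding a vertex `a`, then `h` and `a` have the same neighbours in `P`. -/
theorem SlideSystem.adj_iff_adj (hS : SlideSystem H d St) {S : Bool → Finset V} {h : V}
    (hSt : St S h) {b : Bool} {P : Finset V} (hP : P ⊆ S b) (hPc : ClosedIn H P (S b))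
    (hconn : ConnectedSet H P) {a : V} (haP : a ∉ P)
    (ha : ∀ p ∈ P, (nbrsIn H (insert a P) p).card = d b) {p₀ : V} (hp₀ : p₀ ∈ P)
    (hadj : H.Adj h p₀) {p : V} (hp : p ∈ P) : H.Adj h p ↔ H.Adj a p := by
  have hhP : h ∉ P := fun hh => hS.notMem hSt b (hP hh)
  have h1 := hS.card_nbrsIn_component hSt b (Finset.insert_subset_insert h hP) (by simp)
    (hconn.insert_of_adj hp₀ hadj.symm) (w := p) (by simp [hp])
  have h2 : nbrsIn H (insert h (S b)) p = nbrsIn H (insert h P) p := by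
    ext w
    simp only [mem_nbrsIn, Finset.mem_insert]
    have := hPc p hp w
    have := @hP w
    tauto
  have h3 := ha p hp
  rw [h2, card_nbrsIn_insert hhP] at h1
  rw [card_nbrsIn_insert haP] at h3
  rw [H.adj_comm h, H.adj_comm a]
  by_cases hh : H.Adj p h <;> by_cases ha : H.Adj p a <;> simp_all

theorem SlideSystem.nbrsIn_eq (hS : SlideSystem H d St) {S : Bool → Finset V} {h : V}
    (hSt : St S h) {b : Bool} {P : Finset V} (hP : P ⊆ S b) (hPc : ClosedIn H P (S b))
    (hconn : ConnectedSet H P) {a : V} (haP : a ∉ P)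
    (ha : ∀ p ∈ P, (nbrsIn H (insert a P) p).card = d b) (ha' : (nbrsIn H P a).card = d b)
    {p₀ : V} (hp₀ : p₀ ∈ P) (hadj : H.Adj h p₀) : nbrsIn H (S b) h = nbrsIn H P a := by
  symm
  refine Finset.eq_of_subset_of_card_le ?_ (by rw [ha', hS.card_nbrsIn hSt])
  intro p hp
  rw [mem_nbrsIn] at hp ⊢
  exact ⟨hP hp.1, (hS.adj_iff_adj hSt hP hPc hconn haP ha hp₀ hadj hp.1).2 hp.2⟩

end Slides

section Touching

variable {V : Type*} [DecidableEq V] {H : SimpleGraph V} {d : Bool → ℕ}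
  {St : (Bool → Finset V) → V → Prop}

/-- Some state has a hole whose component on side `b` has exactly `d b + 1` vertices. -/
def HasSmallComponent (H : SimpleGraph V) (d : Bool → ℕ) (St : (Bool → Finset V) → V → Prop)
    (b : Bool) : Prop :=
  ∃ S u K, St S u ∧ u ∈ K ∧ K ⊆ insert u (S b) ∧ ClosedIn H K (insert u (S b)) ∧
    K.card = d b + 1

/-- A state in which the hole `h` touches the remainder `P` of the component `insert a P` that it
left through `a`, while the next component `insert c Q`, left through `c`, is still in place. -/
structure TouchingState (H : SimpleGraph V) (d : Bool → ℕ) (St : (Bool → Finset V) → V → Prop)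
    (S : Bool → Finset V) (h : V) (b : Bool) (P Q : Finset V) (a c : V) : Prop where
  st : St S h
  P_sub : P ⊆ S b
  P_closed : ClosedIn H P (S b)
  P_conn : ConnectedSet H P
  P_card : ∀ p ∈ P, (nbrsIn H (insert a P) p).card = d b
  a_card : (nbrsIn H P a).card = d b
  Q_sub : Q ⊆ S !b
  Q_closed : ClosedIn H Q (S !b)
  Q_conn : ConnectedSet H Q
  Q_card : ∀ q ∈ Q, (nbrsIn H (insert c Q) q).card = d !b
  c_card : (nbrsIn H Q c).card = d !b
  a_mem : a ∈ Q
  c_notMem_Q : c ∉ Q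
  c_notMem_P : c ∉ P
  adj_of_adj : H.Adj a c → ∀ x ∈ Q, x ≠ a → H.Adj a x
  touch : ∃ p ∈ P, H.Adj h p

namespace TouchingState

variable {S : Bool → Finset V} {h : V} {b : Bool} {P Q : Finset V} {a c : V}

theorem a_notMem (hT : TouchingState H d St S h b P Q a c) (hS : SlideSystem H d St) : a ∉ P :=
  fun haP => Finset.disjoint_left.1 (hS.disj hT.st b) (hT.P_sub haP) (hT.Q_sub hT.a_mem)

theorem nbrsIn_hole (hT : TouchingState H d St S h b P Q a c) (hS : SlideSystem H d St) :
    nbrsIn H (S b) h = nbrsIn H P a := by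
  obtain ⟨p, hp, hhp⟩ := hT.touch
  exact hS.nbrsIn_eq hT.st hT.P_sub hT.P_closed hT.P_conn (hT.a_notMem hS) hT.P_card hT.a_card
    hp hhp

theorem adj_hole (hT : TouchingState H d St S h b P Q a c) (hS : SlideSystem H d St) {y : V}
    (hy : y ∈ nbrsIn H P a) : H.Adj h y := by
  rw [← hT.nbrsIn_hole hS] at hy
  exact (mem_nbrsIn.1 hy).2

theorem st_slide (hT : TouchingState H d St S h b P Q a c) (hS : SlideSystem H d St) {y : V}
    (hy : y ∈ nbrsIn H P a) : St (Function.update S b (insert h ((S b).erase y))) y :=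
  hS.slide hT.st b y (hT.P_sub (mem_nbrsIn.1 hy).1) (hT.adj_hole hS hy)

theorem adj_iff_adj_c (hT : TouchingState H d St S h b P Q a c) (hS : SlideSystem H d St) {y : V}
    (hy : y ∈ nbrsIn H P a) {q : V} (hq : q ∈ Q) : H.Adj y q ↔ H.Adj c q := by
  have hb : (!b) ≠ b := by simp
  refine hS.adj_iff_adj (hT.st_slide hS hy) (b := !b) (P := Q) ?_ ?_ hT.Q_conn hT.c_notMem_Q
    hT.Q_card hT.a_mem (mem_nbrsIn.1 hy).2.symm hq
  · rw [Function.update_of_ne hb]; exact hT.Q_sub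
  · rw [Function.update_of_ne hb]; exact hT.Q_closed

theorem exists_mem_nbrsIn (hT : TouchingState H d St S h b P Q a c) (hS : SlideSystem H d St) :
    ∃ y, y ∈ nbrsIn H P a := by
  obtain ⟨p, hp, hhp⟩ := hT.touch
  exact ⟨p, by rw [← hT.nbrsIn_hole hS]; exact mem_nbrsIn.2 ⟨hT.P_sub hp, hhp⟩⟩

theorem adj_a_c (hT : TouchingState H d St S h b P Q a c) (hS : SlideSystem H d St) :
    H.Adj a c := by
  obtain ⟨y, hy⟩ := hT.exists_mem_nbrsIn hS
  exact ((hT.adj_iff_adj_c hS hy hT.a_mem).1 (mem_nbrsIn.1 hy).2.symm).symm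

theorem card_Q (hT : TouchingState H d St S h b P Q a c) (hS : SlideSystem H d St) :
    Q.card = d !b := by
  have h1 := hT.Q_card a hT.a_mem
  have h2 : nbrsIn H (insert c Q) a = (insert c Q).erase a := by
    ext w
    simp only [mem_nbrsIn, Finset.mem_insert, Finset.mem_erase]
    constructor
    · rintro ⟨hw, haw⟩; exact ⟨haw.ne', hw⟩
    · rintro ⟨hwa, rfl | hw⟩
      · exact ⟨Or.inl rfl, hT.adj_a_c hS⟩
      · exact ⟨Or.inr hw, hT.adj_of_adj (hT.adj_a_c hS) w hw hwa⟩
  rw [h2, Finset.card_erase_of_mem (by simp [hT.a_mem]),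
    Finset.card_insert_of_notMem hT.c_notMem_Q] at h1
  omega

theorem adj_c (hT : TouchingState H d St S h b P Q a c) (hS : SlideSystem H d St) {q : V}
    (hq : q ∈ Q) : H.Adj c q := by
  have : nbrsIn H Q c = Q := Finset.eq_of_subset_of_card_le (fun x hx => (mem_nbrsIn.1 hx).1)
    (by rw [hT.c_card, hT.card_Q hS])
  rw [← this] at hq
  exact (mem_nbrsIn.1 hq).2

theorem adj_Q (hT : TouchingState H d St S h b P Q a c) (hS : SlideSystem H d St) {y q : V}
    (hy : y ∈ nbrsIn H P a) (hq : q ∈ Q) : H.Adj y q :=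
  (hT.adj_iff_adj_c hS hy hq).2 (hT.adj_c hS hq)

theorem nbrsIn_side (hT : TouchingState H d St S h b P Q a c) (hS : SlideSystem H d St) {y : V}
    (hy : y ∈ nbrsIn H P a) : nbrsIn H (S !b) y = Q := by
  symm
  refine Finset.eq_of_subset_of_card_le
    (fun q hq => mem_nbrsIn.2 ⟨hT.Q_sub hq, hT.adj_Q hS hy hq⟩) ?_
  have := hS.card_nbrsIn (hT.st_slide hS hy) !b
  rw [Function.update_of_ne (by simp)] at this
  rw [this, hT.card_Q hS]

theorem adj_of_mem_Q (hT : TouchingState H d St S h b P Q a c) (hS : SlideSystem H d St) {p q : V}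
    (hp : p ∈ Q) (hq : q ∈ Q) (hpq : p ≠ q) : H.Adj p q := by
  have h1 := hT.Q_card p hp
  have h2 : nbrsIn H (insert c Q) p = (insert c Q).erase p := by
    refine Finset.eq_of_subset_of_card_le (fun w hw => ?_) ?_
    · rw [mem_nbrsIn] at hw
      exact Finset.mem_erase.2 ⟨hw.2.ne', hw.1⟩
    · rw [h1, Finset.card_erase_of_mem (by simp [hp]),
        Finset.card_insert_of_notMem hT.c_notMem_Q, hT.card_Q hS]
      omega
  have : q ∈ nbrsIn H (insert c Q) p := by rw [h2]; simp [hq, hpq.symm]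
  exact (mem_nbrsIn.1 this).2

theorem hasSmallComponent_not (hT : TouchingState H d St S h b P Q a c)
    (hS : SlideSystem H d St) : HasSmallComponent H d St !b := by
  obtain ⟨y, hy⟩ := hT.exists_mem_nbrsIn hS
  have hst := hT.st_slide hS hy
  have hyS := hS.notMem hst !b
  refine ⟨_, y, insert y Q, hst, by simp, ?_, ?_, ?_⟩
  · rw [Function.update_of_ne (by simp)]; exact Finset.insert_subset_insert _ hT.Q_sub
  · rw [Function.update_of_ne (by simp)]
    intro x hx w hw hxw
    rcases Finset.mem_insert.1 hw with rfl | hwS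
    · simp
    rcases Finset.mem_insert.1 hx with rfl | hx
    · rw [← hT.nbrsIn_side hS hy]; simp [hwS, hxw]
    · exact Finset.mem_insert_of_mem (hT.Q_closed x hx w hwS hxw)
  · rw [Function.update_of_ne (by simp)] at hyS
    rw [Finset.card_insert_of_notMem (fun hh => hyS (hT.Q_sub hh)), hT.card_Q hS]

theorem st_slide_slide (hT : TouchingState H d St S h b P Q a c) (hS : SlideSystem H d St)
    {y q : V} (hy : y ∈ nbrsIn H P a) (hq : q ∈ Q) :
    St (Function.update (Function.update S b (insert h ((S b).erase y))) (!b)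
      (insert y ((S !b).erase q))) q := by
  have := hS.slide (hT.st_slide hS hy) (!b) q
    (by rw [Function.update_of_ne (by simp)]; exact hT.Q_sub hq) (hT.adj_Q hS hy hq)
  rwa [Function.update_of_ne (a := !b) (by simp)] at this

theorem adj_and_adj_of_ne (hT : TouchingState H d St S h b P Q a c) (hS : SlideSystem H d St)
    {y y' q : V} (hy : y ∈ nbrsIn H P a) (hy' : y' ∈ nbrsIn H P a) (hne : y ≠ y') (hq : q ∈ Q) :
    H.Adj y y' ∧ H.Adj q h := by
  have hst := hT.st_slide_slide hS hy hq
  have hPh : nbrsIn H (S b) h ⊆ P := by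
    rw [hT.nbrsIn_hole hS]; exact fun x hx => (mem_nbrsIn.1 hx).1
  obtain ⟨R, hRP, hyR, hRc, hRconn⟩ := exists_component (H := H) (T := insert h (P.erase y))
    (u := y') (by simp [hne.symm, (mem_nbrsIn.1 hy').1])
  have hside : Function.update (Function.update S b (insert h ((S b).erase y))) (!b)
      (insert y ((S !b).erase q)) b = insert h ((S b).erase y) := by
    rw [Function.update_of_ne (by simp), Function.update_self]
  have hhS := hS.notMem hT.st b
  have hyP := (mem_nbrsIn.1 hy).1
  have hhy : h ≠ y := fun hh => hhS (hh ▸ hT.P_sub hyP)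
  have hclosed : ClosedIn H R (insert h ((S b).erase y)) := by
    intro x hx w hw hxw
    refine hRc x hx w ?_ hxw
    rcases Finset.mem_insert.1 hw with rfl | hw
    · simp
    have hw' := Finset.mem_erase.1 hw
    refine Finset.mem_insert_of_mem (Finset.mem_erase.2 ⟨hw'.1, ?_⟩)
    rcases Finset.mem_insert.1 (hRP hx) with rfl | hx
    · exact hPh (mem_nbrsIn.2 ⟨hw'.2, hxw⟩)
    · exact hT.P_closed x (Finset.mem_of_mem_erase hx) w hw'.2 hxw
  have hRS : R ⊆ insert h ((S b).erase y) :=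
    hRP.trans (Finset.insert_subset_insert _ (Finset.erase_subset_erase _ hT.P_sub))
  have hyR' : y ∉ R := fun hh => by simpa [hhy.symm] using hRP hh
  have hdeg : ∀ p ∈ R, (nbrsIn H (insert y R) p).card = d b := by
    intro p hp
    have hp' : p ∈ insert h P := by
      have := hRP hp
      simp only [Finset.mem_insert, Finset.mem_erase] at this ⊢
      tauto
    rw [← hS.card_nbrsIn_component hT.st b (Finset.insert_subset_insert h hT.P_sub) (by simp)
      (hT.P_conn.insert_of_adj hyP (hT.adj_hole hS hy).symm) hp']
    congr 1
    ext w
    simp only [mem_nbrsIn, Finset.mem_insert]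
    constructor
    · rintro ⟨rfl | hw, hpw⟩
      · exact ⟨Or.inr (hT.P_sub hyP), hpw⟩
      · have := hRS hw
        simp only [Finset.mem_insert, Finset.mem_erase] at this
        exact ⟨by tauto, hpw⟩
    · rintro ⟨hw, hpw⟩
      refine ⟨?_, hpw⟩
      by_cases hwy : w = y
      · exact Or.inl hwy
      · exact Or.inr (hclosed p hp w (by simp [hwy, hw]) hpw)
  have key := fun p (hp : p ∈ R) => hS.adj_iff_adj hst (b := b) (P := R) (a := y)
    (by rw [hside]; exact hRS) (by rw [hside]; exact hclosed) hRconn hyR' hdeg hyR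
    (hT.adj_Q hS hy' hq).symm (p := p) hp
  have hhR : h ∈ R := hclosed y' hyR h (by simp) (hT.adj_hole hS hy').symm
  exact ⟨(key y' hyR).1 (hT.adj_Q hS hy' hq).symm, (key h hhR).2 (hT.adj_hole hS hy).symm⟩

theorem nbrsIn_eq_P (hT : TouchingState H d St S h b P Q a c) (hS : SlideSystem H d St) :
    nbrsIn H P a = P := by
  refine hT.P_conn.2 _ (fun x hx => (mem_nbrsIn.1 hx).1) (hT.exists_mem_nbrsIn hS) ?_
  intro x hx w hw hxw
  have hsub : (insert a (nbrsIn H P a)).erase x ⊆ nbrsIn H (insert a P) x := by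
    intro z hz
    simp only [Finset.mem_erase, Finset.mem_insert] at hz
    obtain ⟨hzx, rfl | hz⟩ := hz
    · exact mem_nbrsIn.2 ⟨by simp, (mem_nbrsIn.1 hx).2.symm⟩
    · exact mem_nbrsIn.2 ⟨by simp [(mem_nbrsIn.1 hz).1],
        (hT.adj_and_adj_of_ne hS hx hz (Ne.symm hzx) hT.a_mem).1⟩
  have heq := Finset.eq_of_subset_of_card_le hsub (by
    rw [hT.P_card x (mem_nbrsIn.1 hx).1, Finset.card_erase_of_mem (by simp [hx]),
      Finset.card_insert_of_notMem (by simp), hT.a_card]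
    omega)
  have hwmem : w ∈ nbrsIn H (insert a P) x := by simp [hw, hxw]
  rw [← heq] at hwmem
  simp only [Finset.mem_erase, Finset.mem_insert] at hwmem
  rcases hwmem.2 with rfl | hh
  · exact absurd hw (hT.a_notMem hS)
  · exact hh

theorem card_P (hT : TouchingState H d St S h b P Q a c) (hS : SlideSystem H d St) :
    P.card = d b := by
  rw [← hT.a_card, hT.nbrsIn_eq_P hS]

theorem hasSmallComponent (hT : TouchingState H d St S h b P Q a c) (hS : SlideSystem H d St) :
    HasSmallComponent H d St b := by
  have hhS := hS.notMem hT.st b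
  refine ⟨_, h, insert h P, hT.st, by simp, Finset.insert_subset_insert _ hT.P_sub, ?_, ?_⟩
  · intro x hx w hw hxw
    rcases Finset.mem_insert.1 hw with rfl | hwS
    · simp
    rcases Finset.mem_insert.1 hx with rfl | hx
    · rw [← hT.nbrsIn_eq_P hS, ← hT.nbrsIn_hole hS]; simp [hwS, hxw]
    · exact Finset.mem_insert_of_mem (hT.P_closed x hx w hwS hxw)
  · rw [Finset.card_insert_of_notMem (fun hh => hhS (hT.P_sub hh)), hT.card_P hS]

theorem adj_hole_of_mem_Q (hT : TouchingState H d St S h b P Q a c) (hS : SlideSystem H d St)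
    (hdeg : ∀ T v, (nbrsIn H T v).card ≤ d b + d !b)
    (hd : 2 ≤ d b ∨ 2 ≤ d !b) {q : V} (hq : q ∈ Q) : H.Adj q h := by
  obtain ⟨y, hy⟩ := hT.exists_mem_nbrsIn hS
  by_cases hd2 : 2 ≤ d b
  · obtain ⟨y', hy', hne⟩ := Finset.exists_mem_ne (s := nbrsIn H P a)
      (by rw [hT.a_card]; omega) y
    exact (hT.adj_and_adj_of_ne hS hy hy' hne.symm hq).2
  have hdQ : 2 ≤ d !b := by tauto
  have hyP := (mem_nbrsIn.1 hy).1
  have hst := hT.st_slide_slide hS hy hq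
  set S₂ := Function.update (Function.update S b (insert h ((S b).erase y))) (!b)
      (insert y ((S !b).erase q)) with hS₂
  have hside : S₂ b = insert h ((S b).erase y) := by
    rw [hS₂, Function.update_of_ne (by simp), Function.update_self]
  have hside' : S₂ (!b) = insert y ((S !b).erase q) := by
    rw [hS₂, Function.update_self]
  have hyQ : y ∉ Q := fun hh =>
    Finset.disjoint_left.1 (hS.disj hT.st b) (hT.P_sub hyP) (hT.Q_sub hh)
  obtain ⟨z, hz⟩ : (nbrsIn H (S₂ b) q).Nonempty := by
    rw [← Finset.card_pos, hS.card_nbrsIn hst]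
    have : 0 < (nbrsIn H P a).card := Finset.card_pos.2 ⟨y, hy⟩
    rwa [hT.a_card] at this
  rw [mem_nbrsIn] at hz
  have hzy : z ≠ y := by
    rintro rfl
    have := hz.1
    rw [hside] at this
    simp only [Finset.mem_insert, Finset.mem_erase] at this
    rcases this with h1 | h1
    · exact hS.notMem hT.st b (h1 ▸ hT.P_sub hyP)
    · exact h1.1 rfl
  have hzQ : z ∉ Q.erase q := by
    intro hh
    refine Finset.disjoint_left.1 (hS.disj hst b) hz.1 ?_
    rw [hside']
    exact Finset.mem_insert_of_mem (Finset.erase_subset_erase _ hT.Q_sub hh)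
  have hcy : c ≠ y := fun hh => hT.c_notMem_P (hh ▸ hyP)
  have hcz : c = z := by
    by_contra hcz
    have hle := hdeg (insert c (insert z (insert y (Q.erase q)))) q
    have heq : nbrsIn H (insert c (insert z (insert y (Q.erase q)))) q =
        insert c (insert z (insert y (Q.erase q))) := by
      ext w
      simp only [mem_nbrsIn, and_iff_left_iff_imp, Finset.mem_insert]
      rintro (rfl | rfl | rfl | hw)
      · exact (hT.adj_c hS hq).symm
      · exact hz.2
      · exact (hT.adj_Q hS hy hq).symm
      · rw [Finset.mem_erase] at hw
        exact hT.adj_of_mem_Q hS hq hw.2 hw.1.symm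
    have hpos : 0 < Q.card := Finset.card_pos.2 ⟨q, hq⟩
    rw [heq, Finset.card_insert_of_notMem (by simp [hcz, hcy, hT.c_notMem_Q]),
      Finset.card_insert_of_notMem (by simp only [Finset.mem_insert, not_or]; exact ⟨hzy, hzQ⟩),
      Finset.card_insert_of_notMem (by simp [hyQ]), Finset.card_erase_of_mem hq,
      hT.card_Q hS] at hle
    have := hT.card_Q hS
    omega
  subst hcz
  have hst₃ := hS.slide hst b c hz.1 hz.2
  have hside₃ : Function.update S₂ b (insert q ((S₂ b).erase c)) (!b) =
      insert y ((S !b).erase q) := by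
    rw [Function.update_of_ne (by simp), hside']
  obtain ⟨q', hq', hqq⟩ := Finset.exists_mem_ne (s := Q) (by rw [hT.card_Q hS]; omega) q
  have hins : insert q (insert y (Q.erase q)) = insert y Q := by
    rw [Finset.insert_comm, Finset.insert_erase hq]
  have hcy' : H.Adj c y := by
    refine (hS.adj_iff_adj hst₃ (b := !b) (P := insert y (Q.erase q)) (a := q) ?_ ?_ ?_ ?_ ?_
      (p₀ := q') (by simp [hq', hqq]) (hT.adj_c hS hq') (by simp)).2 (hT.adj_Q hS hy hq).symm
    · rw [hside₃]
      exact Finset.insert_subset_insert _ (Finset.erase_subset_erase _ hT.Q_sub)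
    · rw [hside₃]
      intro x hx w hw hxw
      simp only [Finset.mem_insert, Finset.mem_erase] at hx hw ⊢
      rcases hw with rfl | hw
      · exact Or.inl rfl
      refine Or.inr ⟨hw.1, ?_⟩
      rcases hx with rfl | hx
      · rw [← hT.nbrsIn_side hS hy]; simp [hw.2, hxw]
      · exact hT.Q_closed x hx.2 w hw.2 hxw
    · refine connectedSet_of_center (u := y) (by simp) fun x hx hxy => ?_
      simp only [Finset.mem_insert, Finset.mem_erase] at hx
      exact hT.adj_Q hS hy (hx.resolve_left hxy).2
    · simp only [Finset.mem_insert, Finset.mem_erase]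
      rintro (rfl | hh)
      · exact hyQ hq
      · exact hh.1 rfl
    · intro p hp
      have hpQ : p ∈ insert y Q := hins ▸ Finset.mem_insert_of_mem hp
      rw [hins]
      have : nbrsIn H (insert y Q) p = (insert y Q).erase p := by
        ext w
        simp only [mem_nbrsIn, Finset.mem_erase, Finset.mem_insert] at hpQ ⊢
        constructor
        · rintro ⟨hw, hpw⟩; exact ⟨hpw.ne', hw⟩
        · rintro ⟨hwp, hw⟩
          refine ⟨hw, ?_⟩
          rcases hw with rfl | hw <;> rcases hpQ with rfl | hpQ
          · exact absurd rfl hwp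
          · exact (hT.adj_Q hS hy hpQ).symm
          · exact hT.adj_Q hS hy hw
          · exact hT.adj_of_mem_Q hS hpQ hw hwp.symm
      rw [this, Finset.card_erase_of_mem hpQ, Finset.card_insert_of_notMem hyQ, hT.card_Q hS]
      omega
  have hch : c = h := by
    have := hz.1
    rw [hside] at this
    simp only [Finset.mem_insert, Finset.mem_erase] at this
    rcases this with h1 | h1
    · exact h1
    · exact absurd (hT.P_closed y hyP c h1.2 hcy'.symm) hT.c_notMem_P
  exact hch ▸ hz.2

theorem exists_isClique (hT : TouchingState H d St S h b P Q a c) (hS : SlideSystem H d St)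
    (hdeg : ∀ T v, (nbrsIn H T v).card ≤ d b + d !b)
    (hd : 2 ≤ d b ∨ 2 ≤ d !b) :
    ∃ K : Finset V, K.card = d b + d (!b) + 1 ∧ H.IsClique K := by
  have hmem : ∀ {p}, p ∈ P → p ∈ nbrsIn H P a := fun hp => by rwa [hT.nbrsIn_eq_P hS]
  refine ⟨insert h (P ∪ Q), ?_, ?_⟩
  · rw [Finset.card_insert_of_notMem, Finset.card_union_of_disjoint, hT.card_P hS, hT.card_Q hS]
    · exact Finset.disjoint_of_subset_left hT.P_sub
        (Finset.disjoint_of_subset_right hT.Q_sub (hS.disj hT.st b))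
    · rw [Finset.mem_union]
      rintro (hh | hh)
      · exact hS.notMem hT.st b (hT.P_sub hh)
      · exact hS.notMem hT.st (!b) (hT.Q_sub hh)
  · intro x hx w hw hxw
    simp only [Finset.coe_insert, Finset.coe_union, Set.mem_insert_iff, Set.mem_union,
      Finset.mem_coe] at hx hw
    rcases hx with rfl | hx | hx <;> rcases hw with rfl | hw | hw
    · exact absurd rfl hxw
    · exact hT.adj_hole hS (hmem hw)
    · exact (hT.adj_hole_of_mem_Q hS hdeg hd hw).symm
    · exact (hT.adj_hole hS (hmem hx)).symm
    · exact (hT.adj_and_adj_of_ne hS (hmem hx) (hmem hw) hxw hT.a_mem).1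
    · exact hT.adj_Q hS (hmem hx) hw
    · exact hT.adj_hole_of_mem_Q hS hdeg hd hx
    · exact (hT.adj_Q hS (hmem hw) hx).symm
    · exact hT.adj_of_mem_Q hS hx hw hxw

end TouchingState

end Touching

section Walks

variable {V : Type*} [DecidableEq V] {H : SimpleGraph V} {d : Bool → ℕ}
  {St : (Bool → Finset V) → V → Prop}

theorem ConnectedSet.adj_of_card_nbrsIn_eq_one {B : Finset V} (hB : ConnectedSet H B)
    (h1 : ∀ x ∈ B, (nbrsIn H B x).card = 1) {u w : V} (hu : u ∈ B) (hw : w ∈ B) (huw : w ≠ u) :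
    H.Adj u w := by
  obtain ⟨z, hz⟩ := Finset.card_eq_one.1 (h1 u hu)
  have huz : z ∈ nbrsIn H B u := by simp [hz]
  rw [mem_nbrsIn] at huz
  obtain ⟨z', hz'⟩ := Finset.card_eq_one.1 (h1 z huz.1)
  have hzz : u ∈ nbrsIn H B z := by simp [hu, huz.2.symm]
  rw [hz', Finset.mem_singleton] at hzz
  have : ({u, z} : Finset V) = B := by
    refine hB.2 _ (by simp [Finset.insert_subset_iff, hu, huz.1]) ⟨u, by simp⟩ ?_
    intro x hx y hy hxy
    have hxy' : y ∈ nbrsIn H B x := by simp [hy, hxy]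
    rcases Finset.mem_insert.1 hx with rfl | hx
    · rw [hz] at hxy'
      exact Finset.mem_insert_of_mem hxy'
    · rw [Finset.mem_singleton.1 hx, hz', ← hzz] at hxy'
      simp_all
  rw [← this] at hw
  simp only [Finset.mem_insert, Finset.mem_singleton] at hw
  exact hw.resolve_left huw ▸ huz.2

theorem SlideSystem.exists_slide (hS : SlideSystem H d St) {S : Bool → Finset V} {u : V}
    (h : St S u) {b : Bool} (hd : 1 ≤ d b) :
    ∃ B w, (B ⊆ insert u (S b) ∧ u ∈ B ∧ ClosedIn H B (insert u (S b)) ∧ ConnectedSet H B ∧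
      w ∈ B ∧ w ≠ u ∧ ConnectedSet H (B.erase w) ∧
      (H.Adj u w → ∀ x ∈ B, x ≠ u → H.Adj u x)) ∧
      St (Function.update S b ((insert u (S b)).erase w)) w := by
  obtain ⟨B, hBS, huB, hBc, hBconn⟩ := exists_component (H := H) (Finset.mem_insert_self u (S b))
  obtain ⟨z, hz⟩ : (nbrsIn H (S b) u).Nonempty := by
    rw [← Finset.card_pos, hS.card_nbrsIn h]; omega
  rw [mem_nbrsIn] at hz
  obtain ⟨w, hwB, hwu, hconn, hadj⟩ := hBconn.exists_connectedSet_erase huB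
    (hBc u huB z (by simp [hz.1]) hz.2) hz.2.ne'
  exact ⟨B, w, ⟨hBS, huB, hBc, hBconn, hwB, hwu, hconn, hadj⟩,
    hS.slide_component h b hBS huB hBconn hwB⟩

/-- An infinite sequence of states in which the hole alternately slides inside its component on
the two sides, to a non-cut vertex which is not adjacent to it if possible. -/
structure SlideWalk (H : SimpleGraph V) (St : (Bool → Finset V) → V → Prop)
    (S : ℕ → Bool → Finset V) (u : ℕ → V) (B : ℕ → Finset V) : Prop where
  st : ∀ n, St (S n) (u n)
  sub : ∀ n, B n ⊆ insert (u n) (S n n.bodd)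
  mem : ∀ n, u n ∈ B n
  closed : ∀ n, ClosedIn H (B n) (insert (u n) (S n n.bodd))
  conn : ∀ n, ConnectedSet H (B n)
  succ_mem : ∀ n, u (n + 1) ∈ B n
  succ_ne : ∀ n, u (n + 1) ≠ u n
  conn_erase : ∀ n, ConnectedSet H ((B n).erase (u (n + 1)))
  adj_of_adj : ∀ n, H.Adj (u n) (u (n + 1)) → ∀ x ∈ B n, x ≠ u n → H.Adj (u n) x
  succ : ∀ n, S (n + 1) =
    Function.update (S n) n.bodd ((insert (u n) (S n n.bodd)).erase (u (n + 1)))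

theorem SlideSystem.exists_slideWalk (hS : SlideSystem H d St) (hd : ∀ b, 1 ≤ d b)
    {S₀ : Bool → Finset V} {u₀ : V} (h₀ : St S₀ u₀) : ∃ S u B, SlideWalk H St S u B := by
  choose Bf wf hf hst using fun (p : {p : (Bool → Finset V) × V // St p.1 p.2}) (b : Bool) =>
    hS.exists_slide p.2 (hd b)
  let s : ℕ → {p : (Bool → Finset V) × V // St p.1 p.2} := fun n =>
    Nat.rec ⟨(S₀, u₀), h₀⟩ (fun n p => ⟨(_, _), hst p n.bodd⟩) n
  refine ⟨fun n => (s n).1.1, fun n => (s n).1.2, fun n => Bf (s n) n.bodd, ?_⟩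
  exact
    { st := fun n => (s n).2
      sub := fun n => (hf (s n) n.bodd).1
      mem := fun n => (hf (s n) n.bodd).2.1
      closed := fun n => (hf (s n) n.bodd).2.2.1
      conn := fun n => (hf (s n) n.bodd).2.2.2.1
      succ_mem := fun n => (hf (s n) n.bodd).2.2.2.2.1
      succ_ne := fun n => (hf (s n) n.bodd).2.2.2.2.2.1
      conn_erase := fun n => (hf (s n) n.bodd).2.2.2.2.2.2.1
      adj_of_adj := fun n => (hf (s n) n.bodd).2.2.2.2.2.2.2
      succ := fun n => rfl }

namespace SlideWalk

variable {S : ℕ → Bool → Finset V} {u : ℕ → V} {B : ℕ → Finset V}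

theorem card_nbrsIn (hW : SlideWalk H St S u B) (hS : SlideSystem H d St) (n : ℕ) {x : V}
    (hx : x ∈ B n) : (nbrsIn H (B n) x).card = d n.bodd := by
  rw [nbrsIn_eq_of_closedIn (hW.sub n) (hW.closed n) hx,
    hS.card_nbrsIn_component (hW.st n) _ (hW.sub n) (hW.mem n) (hW.conn n) hx]

/-- The remainders of all components visited before time `n` are still in place. -/
def Intact (H : SimpleGraph V) (S : ℕ → Bool → Finset V) (u : ℕ → V) (B : ℕ → Finset V)
    (n : ℕ) : Prop :=
  ∀ j < n, (B j).erase (u (j + 1)) ⊆ S n j.bodd ∧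
    ClosedIn H ((B j).erase (u (j + 1))) (S n j.bodd)

theorem ne_of_intact (hW : SlideWalk H St S u B) (hS : SlideSystem H d St) {j n : ℕ} (hj : j < n)
    (hn : Intact H S u B n) : u j ≠ u n := by
  intro heq
  have h1 := (hn j hj).1 (Finset.mem_erase.2 ⟨(hW.succ_ne j).symm, hW.mem j⟩)
  exact hS.notMem (hW.st n) _ (heq ▸ h1)

theorem intact_succ (hW : SlideWalk H St S u B) (hS : SlideSystem H d St) {n : ℕ}
    (hn : Intact H S u B n)
    (h : ∀ j < n, j.bodd = n.bodd → ∀ p ∈ (B j).erase (u (j + 1)), ¬ H.Adj (u n) p) :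
    Intact H S u B (n + 1) := by
  intro j hj
  rw [hW.succ n]
  rcases Nat.lt_succ_iff_lt_or_eq.1 hj with hj | rfl
  · by_cases hb : j.bodd = n.bodd
    · have hh := hn j hj
      rw [hb] at hh ⊢
      rw [Function.update_self]
      set P := (B j).erase (u (j + 1))
      have hcl : ClosedIn H P (insert (u n) (S n n.bodd)) := by
        intro x hx y hy hxy
        rcases Finset.mem_insert.1 hy with rfl | hy
        · exact absurd hxy.symm (h j hj hb x hx)
        · exact hh.2 x hx y hy hxy
      have huP : u (n + 1) ∉ P := fun hmem => hS.notMem (hW.st n) _ (hh.1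
        ((hW.conn n).subset_of_closedIn (hW.sub n) hcl (hW.succ_mem n) hmem (hW.mem n)))
      refine ⟨fun x hx => ?_, fun x hx y hy hxy => hcl x hx y (Finset.mem_of_mem_erase hy) hxy⟩
      exact Finset.mem_erase.2 ⟨fun hxu => huP (hxu ▸ hx), Finset.mem_insert_of_mem (hh.1 hx)⟩
    · rw [Function.update_of_ne hb]
      exact hn j hj
  · rw [Function.update_self]
    refine ⟨Finset.erase_subset_erase _ (hW.sub j), fun x hx y hy hxy => ?_⟩
    rw [Finset.mem_erase] at hx hy ⊢
    exact ⟨hy.1, hW.closed j x hx.2 y hy.2 hxy⟩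

theorem exists_not_intact [Finite V] (hW : SlideWalk H St S u B) (hS : SlideSystem H d St) :
    ∃ n, ¬ Intact H S u B n := by
  by_contra! hcon
  refine not_injective_infinite_finite u fun i j hij => ?_
  rcases lt_trichotomy i j with h | h | h
  · exact absurd hij (hW.ne_of_intact hS h (hcon j))
  · exact h
  · exact absurd hij.symm (hW.ne_of_intact hS h (hcon i))

theorem exists_touch [Finite V] (hW : SlideWalk H St S u B) (hS : SlideSystem H d St) :
    ∃ m, (∀ n ≤ m, Intact H S u B n) ∧ ∃ j, j + 2 ≤ m ∧ j.bodd = m.bodd ∧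
      ∃ p ∈ (B j).erase (u (j + 1)), H.Adj (u m) p := by
  classical
  have hex := hW.exists_not_intact hS
  obtain ⟨m, hm⟩ : ∃ m, Nat.find hex = m + 1 := by
    refine Nat.exists_eq_succ_of_ne_zero fun h0 => Nat.find_spec hex ?_
    rw [h0]
    intro j hj
    omega
  have hint : ∀ n ≤ m, Intact H S u B n := fun n hn => by
    by_contra hcon
    have := Nat.find_min' hex hcon
    omega
  refine ⟨m, hint, ?_⟩
  by_contra! hcon
  refine Nat.find_spec hex ?_
  rw [hm]
  refine hW.intact_succ hS (hint m le_rfl) fun j hj hb => hcon j ?_ hb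
  by_contra hlt
  obtain rfl : m = j + 1 := by omega
  simp at hb

theorem touchingState (hW : SlideWalk H St S u B) (hS : SlideSystem H d St) {m j : ℕ}
    (hm : ∀ n ≤ m, Intact H S u B n) (hj : j + 2 ≤ m)
    (hp : ∃ p ∈ (B j).erase (u (j + 1)), H.Adj (u m) p) :
    TouchingState H d St (S m) (u m) j.bodd ((B j).erase (u (j + 1)))
      ((B (j + 1)).erase (u (j + 2))) (u (j + 1)) (u (j + 2)) := by
  have hP := hm m le_rfl j (by omega)
  have hQ := hm m le_rfl (j + 1) (by omega)
  rw [Nat.bodd_succ] at hQ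
  exact
    { st := hW.st m
      P_sub := hP.1
      P_closed := hP.2
      P_conn := hW.conn_erase j
      P_card := fun p hp => by
        rw [Finset.insert_erase (hW.succ_mem j)]
        exact hW.card_nbrsIn hS j (Finset.mem_of_mem_erase hp)
      a_card := by
        rw [nbrsIn_erase_self]
        exact hW.card_nbrsIn hS j (hW.succ_mem j)
      Q_sub := hQ.1
      Q_closed := hQ.2
      Q_conn := hW.conn_erase (j + 1)
      Q_card := fun q hq => by
        rw [Finset.insert_erase (hW.succ_mem (j + 1)), ← Nat.bodd_succ]
        exact hW.card_nbrsIn hS (j + 1) (Finset.mem_of_mem_erase hq)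
      c_card := by
        rw [nbrsIn_erase_self, ← Nat.bodd_succ]
        exact hW.card_nbrsIn hS (j + 1) (hW.succ_mem (j + 1))
      a_mem := Finset.mem_erase.2 ⟨(hW.succ_ne (j + 1)).symm, hW.mem (j + 1)⟩
      c_notMem_Q := by simp
      c_notMem_P := fun hc => hS.notMem (hW.st (j + 2)) _ ((hm (j + 2) hj j (by omega)).1 hc)
      adj_of_adj := fun h x hx => hW.adj_of_adj (j + 1) h x (Finset.mem_of_mem_erase hx)
      touch := hp }

end SlideWalk

/-- A slide system contains components on `d b + 1` vertices on both sides and either a clique on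
`d false + d true + 1` vertices or, if `d false = d true = 1`, an odd cycle. -/
theorem SlideSystem.exists_clique_or_cycle [Finite V] (hS : SlideSystem H d St)
    (hd : ∀ b, 1 ≤ d b) (hdeg : ∀ T v, (nbrsIn H T v).card ≤ d false + d true)
    (hne : ∃ S u, St S u) :
    (∀ b, HasSmallComponent H d St b) ∧
      ((∃ K : Finset V, K.card = d false + d true + 1 ∧ H.IsClique K) ∨
        ((∀ b, d b = 1) ∧ ∃ n, Odd n ∧ 3 ≤ n ∧ HasCopy (cycleGraph n) H)) := by
  obtain ⟨S₀, u₀, h₀⟩ := hne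
  obtain ⟨S, u, B, hW⟩ := hS.exists_slideWalk hd h₀
  obtain ⟨m, hm, j, hj, hb, hp⟩ := hW.exists_touch hS
  have hT := hW.touchingState hS hm hj hp
  have hsum : d j.bodd + d (!j.bodd) = d false + d true := by
    cases j.bodd <;> simp [add_comm]
  have hor : ∀ b, b = j.bodd ∨ b = !j.bodd := by
    intro b; cases b <;> cases j.bodd <;> simp
  refine ⟨fun b => ?_, ?_⟩
  · rcases hor b with rfl | rfl
    · exact hT.hasSmallComponent hS
    · exact hT.hasSmallComponent_not hS
  by_cases hd2 : 2 ≤ d j.bodd ∨ 2 ≤ d (!j.bodd)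
  · left
    rw [← hsum] at hdeg ⊢
    exact hT.exists_isClique hS hdeg hd2
  right
  have hd1 : ∀ b, d b = 1 := by
    intro b
    have := hd b
    rcases hor b with rfl | rfl <;> omega
  refine ⟨hd1, m - j + 1, ?_, by omega, ?_⟩
  · have h1 : (m - j).bodd = false := by
      have := Nat.bodd_add (m - j) j
      rw [Nat.sub_add_cancel (by omega), ← hb] at this
      revert this
      cases (m - j).bodd <;> cases j.bodd <;> simp
    refine Even.add_one ?_
    rw [Nat.even_iff, Nat.mod_two_of_bodd, h1]
    rfl
  have hadj : ∀ i, H.Adj (u i) (u (i + 1)) := fun i =>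
    (hW.conn i).adj_of_card_nbrsIn_eq_one
      (fun x hx => by rw [hW.card_nbrsIn hS i hx, hd1]) (hW.mem i) (hW.succ_mem i) (hW.succ_ne i)
  have hclose : H.Adj (u m) (u j) := by
    obtain ⟨p, hpP, hadjp⟩ := hp
    have hcard := hT.card_P hS
    rw [hd1] at hcard
    have := Finset.card_le_one.1 hcard.le p hpP (u j)
      (Finset.mem_erase.2 ⟨(hW.succ_ne j).symm, hW.mem j⟩)
    exact this ▸ hadjp
  have hstep : ∀ i i' : Fin (m - j + 1), (i' - i).val = 1 → H.Adj (u (j + i)) (u (j + i')) := by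
    intro i i' h
    rw [Fin.sub_def] at h
    simp only at h
    have hi := i.2
    have hi' := i'.2
    rcases Nat.lt_or_ge (m - j + 1 - i + i') (m - j + 1) with hlt | hge
    · rw [Nat.mod_eq_of_lt hlt] at h
      have h1 : j + i.val = m := by omega
      have h2 : j + i'.val = j := by omega
      rw [h1, h2]
      exact hclose
    · rw [Nat.mod_eq_sub_mod hge, Nat.mod_eq_of_lt (by omega)] at h
      have h1 : j + i'.val = j + i.val + 1 := by omega
      rw [h1]
      exact hadj _
  refine ⟨⟨fun i => u (j + i), fun {i i'} h => ?_⟩, ?_⟩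
  · rcases cycleGraph_adj'.1 h with h | h
    · exact (hstep _ _ h).symm
    · exact hstep _ _ h
  · intro i i' h
    have h : u (j + i) = u (j + i') := h
    have hi := i.2
    have hi' := i'.2
    ext
    rcases lt_trichotomy i.val i'.val with hlt | heq | hlt
    · exact absurd h (hW.ne_of_intact hS (by omega) (hm _ (by omega)))
    · exact heq
    · exact absurd h.symm (hW.ne_of_intact hS (by omega) (hm _ (by omega)))

end Walks

section Partition

variable {V : Type*} [DecidableEq V] {H : SimpleGraph V}

/-- A hereditary property of vertex sets that is closed under disjoint unions without edges in
between and under adding vertices with fewer than `d` neighbours. -/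
structure SparseProperty (H : SimpleGraph V) (d : ℕ) (P : Finset V → Prop) : Prop where
  empty : P ∅
  mono : ∀ {S T}, S ⊆ T → P T → P S
  insert : ∀ {T v}, P T → (nbrsIn H T v).card < d → P (insert v T)
  union : ∀ {S T}, P S → P T → Disjoint S T → (∀ x ∈ S, ∀ y ∈ T, ¬ H.Adj x y) → P (S ∪ T)

theorem SparseProperty.of_card_le {d : ℕ} {P : Finset V → Prop} (hP : SparseProperty H d P)
    {W : Finset V} (hW : W.card ≤ d) : P W := by
  induction W using Finset.induction_on with
  | empty => exact hP.empty
  | insert v W hv ih =>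
    rw [Finset.card_insert_of_notMem hv] at hW
    refine hP.insert (ih (by omega)) (lt_of_le_of_lt (Finset.card_le_card ?_) hW)
    exact fun x hx => (mem_nbrsIn.1 hx).1

/-- Two sparse properties split the vertex set, with a largest possible first part, unless `H`
contains a large clique or an odd cycle and both properties fail for some small set. -/
theorem exists_partition_or_clique_or_cycle [Fintype V] {Pr : Bool → Finset V → Prop}
    {d : Bool → ℕ} (hPr : ∀ b, SparseProperty H (d b) (Pr b))
    (hd : ∀ b, 1 ≤ d b) (hdeg : ∀ T v, (nbrsIn H T v).card ≤ d false + d true) :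
    (∃ A B, Pr false A ∧ Pr true B ∧ Disjoint A B ∧ A ∪ B = Finset.univ ∧
        ∀ T, Pr false T → T.card ≤ A.card) ∨
      ((∀ b, ∃ K, ¬ Pr b K ∧ K.card = d b + 1) ∧
        ((∃ K : Finset V, K.card = d false + d true + 1 ∧ H.IsClique K) ∨
          ((∀ b, d b = 1) ∧ ∃ n, Odd n ∧ 3 ≤ n ∧ HasCopy (cycleGraph n) H))) := by
  classical
  obtain ⟨A₀, hA₀, hA₀max⟩ := (Finset.univ.filter (Pr false)).exists_max_image Finset.card
    ⟨∅, by simp [(hPr false).empty]⟩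
  have hA₀max : ∀ T, Pr false T → T.card ≤ A₀.card := fun T hT => hA₀max T (by simp [hT])
  obtain ⟨⟨A, B⟩, hAB, hABmax⟩ := (Finset.univ.filter fun p : Finset V × Finset V =>
    Pr false p.1 ∧ Pr true p.2 ∧ Disjoint p.1 p.2 ∧ p.1.card = A₀.card).exists_max_image
    (fun p => p.2.card) ⟨(A₀, ∅), by simpa [(hPr true).empty] using hA₀⟩
  simp only [Finset.mem_filter, Finset.mem_univ, true_and] at hAB hABmax
  obtain ⟨hA, hB, hdisj, hcard⟩ := hAB
  by_cases huniv : A ∪ B = Finset.univ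
  · exact Or.inl ⟨A, B, hA, hB, hdisj, huniv, fun T hT => hcard ▸ hA₀max T hT⟩
  right
  let N : Bool → ℕ := fun b => if b then B.card else A₀.card
  let St : (Bool → Finset V) → V → Prop := fun S u =>
    (∀ b, Pr b (S b)) ∧ (∀ b, Disjoint (S b) (S !b)) ∧ (∀ b, (S b).card = N b) ∧ ∀ b, u ∉ S b
  have hnot : ∀ S u, St S u → ∀ b, ¬ Pr b (insert u (S b)) := by
    rintro S u ⟨hSP, hdis, hN, hu⟩ b hcon
    have hf : (S false).card = A₀.card := hN false
    have ht : (S true).card = B.card := hN true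
    cases b with
    | false =>
      have := hA₀max _ hcon
      rw [Finset.card_insert_of_notMem (hu false)] at this
      omega
    | true =>
      have := hABmax (S false, insert u (S true)) ⟨hSP false, hcon, ?_, hf⟩
      · rw [Finset.card_insert_of_notMem (hu true)] at this
        omega
      · rw [Finset.disjoint_insert_right]
        exact ⟨hu false, hdis false⟩
  have hle : ∀ S u, St S u → ∀ b, d b ≤ (nbrsIn H (S b) u).card := by
    intro S u hSt b
    by_contra! hlt
    exact hnot S u hSt b ((hPr b).insert (hSt.1 b) hlt)
  have hnb : ∀ S u, St S u → ∀ b, (nbrsIn H (S b) u).card = d b := by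
    intro S u hSt
    have h0 := hle S u hSt false
    have h1 := hle S u hSt true
    have hd01 : Disjoint (S false) (S true) := hSt.2.1 false
    have h2 : (nbrsIn H (S false) u).card + (nbrsIn H (S true) u).card ≤ d false + d true := by
      refine le_trans ?_ (hdeg (S false ∪ S true) u)
      rw [← Finset.card_union_of_disjoint (Finset.disjoint_of_subset_left
        (fun x hx => (mem_nbrsIn.1 hx).1) (Finset.disjoint_of_subset_right
          (fun x hx => (mem_nbrsIn.1 hx).1) hd01))]
      exact Finset.card_le_card (Finset.union_subset (nbrsIn_mono Finset.subset_union_left u)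
        (nbrsIn_mono Finset.subset_union_right u))
    intro b
    cases b <;> omega
  have hsys : SlideSystem H d St :=
    { notMem := fun h => h.2.2.2
      disj := fun h => h.2.1
      card_nbrsIn := fun h => hnb _ _ h
      slide := by
        intro S u hSt b w hw huw
        have hsub := hnb S u hSt b
        obtain ⟨hSP, hdis, hN, hu⟩ := hSt
        have hcardS : (insert u ((S b).erase w)).card = (S b).card := by
          rw [Finset.card_insert_of_notMem (by simp [hu b]), Finset.card_erase_add_one hw]
        have hPrb : Pr b (insert u ((S b).erase w)) := by
          refine (hPr b).insert ((hPr b).mono (Finset.erase_subset _ _) (hSP b)) ?_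
          rw [← hsub]
          refine Finset.card_lt_card ⟨nbrsIn_mono (Finset.erase_subset _ _) u, fun hcon => ?_⟩
          have := hcon (mem_nbrsIn.2 ⟨hw, huw⟩)
          simp at this
        have hwb : w ∉ S !b := fun h => Finset.disjoint_left.1 (hdis b) hw h
        have hdisb : Disjoint (insert u ((S b).erase w)) (S !b) := by
          rw [Finset.disjoint_insert_left]
          exact ⟨hu !b, Finset.disjoint_of_subset_left (Finset.erase_subset _ _) (hdis b)⟩
        have hwu : w ∉ insert u ((S b).erase w) := by simp [huw.ne']
        have hbb : (!b) ≠ b := by simp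
        refine ⟨fun c => ?_, fun c => ?_, fun c => ?_, fun c => ?_⟩ <;>
          rcases Bool.eq_or_eq_not c b with rfl | rfl
        · rwa [Function.update_self]
        · rw [Function.update_of_ne hbb]
          exact hSP _
        · rwa [Function.update_self, Function.update_of_ne hbb]
        · rw [Bool.not_not, Function.update_self, Function.update_of_ne hbb]
          exact hdisb.symm
        · rw [Function.update_self, hcardS, hN]
        · rw [Function.update_of_ne hbb, hN]
        · rwa [Function.update_self]
        · rwa [Function.update_of_ne hbb] }
  obtain ⟨hK, hrest⟩ := hsys.exists_clique_or_cycle hd hdeg (by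
    obtain ⟨u, hu⟩ : ∃ u, u ∉ A ∪ B := by
      by_contra! hcon
      exact huniv (Finset.eq_univ_iff_forall.2 hcon)
    rw [Finset.mem_union, not_or] at hu
    refine ⟨fun b => if b then B else A, u, ?_, ?_, ?_, ?_⟩ <;>
      simp [N, hA, hB, hdisj, hdisj.symm, hcard, hu])
  refine ⟨fun b => ?_, hrest⟩
  obtain ⟨S, u, K, hSt, huK, hKS, hKc, hKcard⟩ := hK b
  refine ⟨K, fun hcon => hnot S u hSt b ?_, hKcard⟩
  rw [← Finset.union_sdiff_of_subset hKS]
  refine (hPr b).union hcon ((hPr b).mono (T := S b) ?_ (hSt.1 b)) Finset.disjoint_sdiff ?_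
  · intro x hx
    rw [Finset.mem_sdiff, Finset.mem_insert] at hx
    exact hx.1.resolve_left fun h => hx.2 (h ▸ huK)
  · intro x hx y hy hxy
    rw [Finset.mem_sdiff] at hy
    exact hy.2 (hKc x hx y hy.1 hxy)

end Partition

section Splits

variable {V κ : Type*}

theorem exists_eqOn_eqOn [DecidableEq V] {A B : Finset V} (hAB : Disjoint A B) (c c' : V → κ) :
    ∃ g : V → κ, (∀ x ∈ A, g x = c x) ∧ ∀ x ∈ B, g x = c' x :=
  ⟨A.piecewise c c', fun _ hx => A.piecewise_eq_of_mem _ _ hx,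
    fun _ hx => A.piecewise_eq_of_notMem _ _ fun h => Finset.disjoint_left.1 hAB h hx⟩

variable [DecidableEq κ]

/-- `W` can be coloured with colours from `I` such that the class of each colour `i` has
property `P i`. -/
def SplitsOn (P : κ → Finset V → Prop) (I : Finset κ) (W : Finset V) : Prop :=
  ∃ c : V → κ, (∀ v ∈ W, c v ∈ I) ∧ ∀ i ∈ I, P i (W.filter fun v => c v = i)

theorem filter_eq_congr {A : Finset V} {c g : V → κ} (h : ∀ x ∈ A, g x = c x) {i : κ} :
    (A.filter fun x => g x = i) = A.filter fun x => c x = i :=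
  Finset.filter_congr fun x hx => by rw [h x hx]

variable {P : κ → Finset V → Prop} {d : κ → ℕ}

theorem splitsOn_singleton {i : κ} {W : Finset V} : SplitsOn P {i} W ↔ P i W := by
  constructor
  · rintro ⟨c, hcI, hc⟩
    have := hc i (by simp)
    rwa [Finset.filter_true_of_mem fun x hx => by simpa using hcI x hx] at this
  · exact fun h => ⟨fun _ => i, by simp, by simpa using h⟩

variable [DecidableEq V] {H : SimpleGraph V}

theorem sparseProperty_splitsOn [Nonempty κ] (hP : ∀ i, SparseProperty H (d i) (P i))
    (I : Finset κ) : SparseProperty H (∑ i ∈ I, d i) (SplitsOn P I) where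
  empty := ⟨fun _ => Classical.arbitrary κ, by simp, fun i _ => by simpa using (hP i).empty⟩
  mono := by
    rintro S T hST ⟨c, hcI, hc⟩
    exact ⟨c, fun v hv => hcI v (hST hv),
      fun i hi => (hP i).mono (Finset.filter_subset_filter _ hST) (hc i hi)⟩
  insert := by
    rintro T v ⟨c, hcI, hc⟩ hlt
    by_cases hv : v ∈ T
    · rw [Finset.insert_eq_of_mem hv]
      exact ⟨c, hcI, hc⟩
    rw [Finset.card_eq_sum_card_fiberwise (f := c) (t := I)
      fun x hx => hcI x (mem_nbrsIn.1 hx).1] at hlt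
    obtain ⟨i, hi, hlt⟩ := Finset.exists_lt_of_sum_lt hlt
    have hne : ∀ x ∈ T, Function.update c v i x = c x := fun x hx =>
      Function.update_of_ne (ne_of_mem_of_not_mem hx hv) _ _
    refine ⟨Function.update c v i, ?_, fun j hj => ?_⟩
    · rw [Finset.forall_mem_insert, Function.update_self]
      exact ⟨hi, fun x hx => by rw [hne x hx]; exact hcI x hx⟩
    · rw [Finset.filter_insert, Function.update_self, filter_eq_congr hne]
      split_ifs with hij
      · subst hij
        refine (hP i).insert (hc i hi) (lt_of_le_of_lt (Finset.card_le_card ?_) hlt)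
        intro x hx
        simp only [mem_nbrsIn, Finset.mem_filter] at hx ⊢
        exact ⟨⟨hx.1.1, hx.2⟩, hx.1.2⟩
      · exact hc j hj
  union := by
    rintro S T ⟨c, hcI, hc⟩ ⟨c', hcI', hc'⟩ hST hadj
    obtain ⟨g, hS, hT⟩ := exists_eqOn_eqOn hST c c'
    refine ⟨g, ?_, fun i hi => ?_⟩
    · intro x hx
      rcases Finset.mem_union.1 hx with hx | hx
      · rw [hS x hx]; exact hcI x hx
      · rw [hT x hx]; exact hcI' x hx
    · rw [Finset.filter_union, filter_eq_congr hS, filter_eq_congr hT]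
      refine (hP i).union (hc i hi) (hc' i hi) (Finset.disjoint_filter_filter hST) ?_
      exact fun x hx y hy => hadj x (Finset.mem_filter.1 hx).1 y (Finset.mem_filter.1 hy).1

theorem SplitsOn.union {I J : Finset κ} {A B : Finset V} (hA : SplitsOn P I A)
    (hB : SplitsOn P J B) (hIJ : Disjoint I J) (hAB : Disjoint A B) :
    SplitsOn P (I ∪ J) (A ∪ B) := by
  obtain ⟨c, hcI, hc⟩ := hA
  obtain ⟨c', hcJ, hc'⟩ := hB
  obtain ⟨g, hA, hB⟩ := exists_eqOn_eqOn hAB c c'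
  refine ⟨g, ?_, fun i hi => ?_⟩
  · intro x hx
    rw [Finset.mem_union]
    rcases Finset.mem_union.1 hx with hx | hx
    · rw [hA x hx]; exact Or.inl (hcI x hx)
    · rw [hB x hx]; exact Or.inr (hcJ x hx)
  · rw [Finset.filter_union, filter_eq_congr hA, filter_eq_congr hB]
    rcases Finset.mem_union.1 hi with hi | hi
    · rw [Finset.filter_false_of_mem (p := fun x => c' x = i), Finset.union_empty]
      · exact hc i hi
      · rintro x hx rfl
        exact Finset.disjoint_left.1 hIJ hi (hcJ x hx)
    · rw [Finset.filter_false_of_mem (p := fun x => c x = i), Finset.empty_union]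
      · exact hc' i hi
      · rintro x hx rfl
        exact Finset.disjoint_left.1 hIJ (hcI x hx) hi

/-- If a set with one vertex too many cannot be coloured, then each of the properties fails for
a set with one vertex too many. -/
theorem exists_not_of_not_splitsOn (hP : ∀ i, SparseProperty H (d i) (P i)) {I : Finset κ}
    {K : Finset V} (hK : ¬ SplitsOn P I K) (hcard : K.card = (∑ i ∈ I, d i) + 1) {i : κ}
    (hi : i ∈ I) : ∃ A : Finset V, A.card = d i + 1 ∧ ¬ P i A := by
  have := Nonempty.intro i
  have hsum := Finset.add_sum_erase I d hi
  obtain ⟨A, hAK, hA⟩ := Finset.exists_subset_card_eq (s := K) (n := d i + 1) (by omega)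
  refine ⟨A, hA, fun hPA => hK ?_⟩
  have hB : SplitsOn P (I.erase i) (K \ A) := (sparseProperty_splitsOn hP _).of_card_le (by
    rw [Finset.card_sdiff_of_subset hAK]; omega)
  have := (splitsOn_singleton.2 hPA).union hB (by simp) Finset.disjoint_sdiff
  rwa [Finset.union_sdiff_of_subset hAK, ← Finset.insert_eq, Finset.insert_erase hi] at this

end Splits

section Free

variable {α V : Type*}

theorem forall_of_connected {G : SimpleGraph α} (hG : G.Connected) {p : α → Prop} {x : α}
    (hx : p x) (hadj : ∀ y z, p y → G.Adj y z → p z) (y : α) : p y := by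
  obtain ⟨w⟩ := hG.preconnected x y
  induction w with
  | nil => exact hx
  | cons h _ ih => exact ih (hadj _ _ hx h)

theorem hasCopy_induce_iff {G : SimpleGraph α} {H : SimpleGraph V} {W : Set V} :
    HasCopy G (H.induce W) ↔ ∃ f : G →g H, Function.Injective f ∧ ∀ x, f x ∈ W := by
  constructor
  · rintro ⟨f, hf⟩
    exact ⟨⟨fun x => f x, fun h => f.map_adj h⟩, fun x y h => hf (Subtype.ext h),
      fun x => (f x).2⟩
  · rintro ⟨f, hf, hW⟩
    exact ⟨⟨fun x => ⟨f x, hW x⟩, fun h => f.map_adj h⟩, fun x y h => hf (Subtype.ext_iff.1 h)⟩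

/-- An injective homomorphism into a connected graph that does not lose any degrees is onto, and
is an isomorphism. -/
theorem nonempty_iso_of_degree_le [Fintype α] [Nonempty α] [Fintype V] {G : SimpleGraph α}
    {H : SimpleGraph V} [DecidableRel G.Adj] [DecidableRel H.Adj] (hH : H.Connected)
    (f : G →g H) (hf : Function.Injective f) (hdeg : ∀ x, H.degree (f x) ≤ G.degree x) :
    Nonempty (H ≃g G) := by
  classical
  have himage : ∀ x, (G.neighborFinset x).image f = H.neighborFinset (f x) := by
    intro x
    refine Finset.eq_of_subset_of_card_le ?_ ?_
    · intro y hy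
      obtain ⟨z, hz, rfl⟩ := Finset.mem_image.1 hy
      rw [mem_neighborFinset] at hz ⊢
      exact f.map_adj hz
    · rw [Finset.card_image_of_injective _ hf, card_neighborFinset_eq_degree,
        card_neighborFinset_eq_degree]
      exact hdeg x
  have hadj : ∀ x v, H.Adj (f x) v → ∃ y, G.Adj x y ∧ f y = v := by
    intro x v h
    rw [← mem_neighborFinset, ← himage x, Finset.mem_image] at h
    simpa using h
  have hsurj : Function.Surjective f := by
    refine forall_of_connected hH (x := f (Classical.arbitrary α)) ⟨_, rfl⟩ ?_
    rintro _ v ⟨x, rfl⟩ h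
    obtain ⟨y, -, hy⟩ := hadj x v h
    exact ⟨y, hy⟩
  refine ⟨Iso.symm ⟨Equiv.ofBijective f ⟨hf, hsurj⟩, ?_⟩⟩
  intro x y
  refine ⟨fun h => ?_, fun h => f.map_adj h⟩
  obtain ⟨z, hz, hzy⟩ := hadj x _ h
  exact hf hzy ▸ hz

variable {ι : Type*} {β : ι → Type*}

/-- `W` induces a subgraph of `H` without copies of members of the family `𝒢`. -/
def FreeOn (𝒢 : ∀ j, SimpleGraph (β j)) (H : SimpleGraph V) (W : Set V) : Prop :=
  ∀ j, ¬ HasCopy (𝒢 j) (H.induce W)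

variable {𝒢 : ∀ j, SimpleGraph (β j)} {H : SimpleGraph V}

theorem FreeOn.mono {S T : Set V} (h : S ⊆ T) (hT : FreeOn 𝒢 H T) : FreeOn 𝒢 H S := by
  intro j hj
  obtain ⟨f, hf, hfS⟩ := hasCopy_induce_iff.1 hj
  exact hT j (hasCopy_induce_iff.2 ⟨f, hf, fun x => h (hfS x)⟩)

variable [∀ j, Fintype (β j)] [∀ j, DecidableRel (𝒢 j).Adj]

theorem sparseProperty_freeOn [DecidableEq V] (h𝒢 : ∀ j, (𝒢 j).Connected) :
    SparseProperty H (⨅ j, (𝒢 j).minDegree) fun W => FreeOn 𝒢 H (W : Set V) where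
  empty := by
    intro j hj
    obtain ⟨f, -, hf⟩ := hasCopy_induce_iff.1 hj
    obtain ⟨x⟩ := (h𝒢 j).nonempty
    simpa using hf x
  mono := fun hST hT => hT.mono (Finset.coe_subset.2 hST)
  insert := by
    intro T v hT hlt j hj
    obtain ⟨f, hf, hfT⟩ := hasCopy_induce_iff.1 hj
    by_cases hv : ∃ x, f x = v
    · obtain ⟨x, rfl⟩ := hv
      have h1 : ((𝒢 j).neighborFinset x).image f ⊆ nbrsIn H T (f x) := by
        intro w hw
        obtain ⟨z, hz, rfl⟩ := Finset.mem_image.1 hw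
        rw [mem_neighborFinset] at hz
        refine mem_nbrsIn.2 ⟨?_, f.map_adj hz⟩
        exact Finset.mem_of_mem_insert_of_ne (hfT z) (hf.ne hz.ne')
      have h2 := Finset.card_le_card h1
      rw [Finset.card_image_of_injective _ hf, card_neighborFinset_eq_degree] at h2
      have h3 := (𝒢 j).minDegree_le_degree x
      have h4 : ⨅ j, (𝒢 j).minDegree ≤ (𝒢 j).minDegree := ciInf_le (OrderBot.bddBelow _) j
      omega
    · refine hT j (hasCopy_induce_iff.2 ⟨f, hf, fun x => ?_⟩)
      exact Finset.mem_of_mem_insert_of_ne (hfT x) fun h => hv ⟨x, h⟩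
  union := by
    intro S T hS hT _ hadj j hj
    obtain ⟨f, hf, hfST⟩ := hasCopy_induce_iff.1 hj
    simp only [Finset.coe_union, Set.mem_union, Finset.mem_coe] at hfST
    obtain ⟨x⟩ := (h𝒢 j).nonempty
    rcases hfST x with hx | hx
    · refine hS j (hasCopy_induce_iff.2 ⟨f, hf, ?_⟩)
      refine forall_of_connected (h𝒢 j) (x := x) hx fun y z hy hyz => ?_
      exact (hfST z).resolve_right fun hz => hadj _ hy _ hz (f.map_adj hyz)
    · refine hT j (hasCopy_induce_iff.2 ⟨f, hf, ?_⟩)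
      refine forall_of_connected (h𝒢 j) (x := x) hx fun y z hy hyz => ?_
      exact (hfST z).resolve_left fun hz => hadj _ hz _ hy (f.map_adj hyz).symm

theorem exists_iso_top_of_not_freeOn {d : ℕ} (hd : d = ⨅ j, (𝒢 j).minDegree)
    (h𝒢 : ∀ j, (𝒢 j).Connected) {A : Finset V} (hA : ¬ FreeOn 𝒢 H (A : Set V))
    (hcard : A.card = d + 1) : ∃ j, Nonempty (𝒢 j ≃g (⊤ : SimpleGraph (Fin (d + 1)))) := by
  classical
  simp only [FreeOn, not_forall, not_not] at hA
  obtain ⟨j, hj⟩ := hA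
  obtain ⟨f, hf, hfA⟩ := hasCopy_induce_iff.1 hj
  have hle : Fintype.card (β j) ≤ d + 1 := by
    rw [← hcard, ← Finset.card_univ, ← Finset.card_image_of_injective _ hf]
    refine Finset.card_le_card fun y hy => ?_
    obtain ⟨x, -, rfl⟩ := Finset.mem_image.1 hy
    exact hfA x
  have hdeg : ∀ x, d ≤ (𝒢 j).degree x := fun x =>
    hd ▸ (ciInf_le (OrderBot.bddBelow _) j).trans ((𝒢 j).minDegree_le_degree x)
  obtain ⟨x₀⟩ := (h𝒢 j).nonempty
  have hlt := (𝒢 j).degree_lt_card_verts x₀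
  have hcardβ : Fintype.card (β j) = d + 1 := by
    have := hdeg x₀
    omega
  have htop : 𝒢 j = ⊤ := by
    ext x y
    rw [top_adj]
    refine ⟨fun h => h.ne, fun hxy => ?_⟩
    have heq : (𝒢 j).neighborFinset x = Finset.univ.erase x := by
      refine Finset.eq_of_subset_of_card_le (fun z hz => ?_) ?_
      · rw [mem_neighborFinset] at hz
        simpa using hz.ne'
      · rw [Finset.card_erase_of_mem (Finset.mem_univ _), Finset.card_univ, hcardβ,
          card_neighborFinset_eq_degree]
        exact hdeg x
    rw [← mem_neighborFinset, heq]
    simpa using hxy.symm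
  exact ⟨j, htop ▸ ⟨Iso.completeGraph (Fintype.equivFinOfCardEq hcardβ)⟩⟩

theorem nonempty_iso_top_of_isClique [Fintype V] [DecidableRel H.Adj] (hH : H.Connected)
    {K : Finset V} (hK : H.IsClique K) (hcard : K.card = H.maxDegree + 1) :
    Nonempty (H ≃g (⊤ : SimpleGraph (Fin (H.maxDegree + 1)))) := by
  classical
  let e := K.equivFinOfCardEq hcard
  refine nonempty_iso_of_degree_le hH ⟨fun x => (e.symm x : V), fun {x y} h => ?_⟩ ?_ fun x => ?_
  · exact hK (e.symm x).2 (e.symm y).2 fun h' => h.ne (e.symm.injective (Subtype.ext h'))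
  · exact fun x y h => e.symm.injective (Subtype.ext h)
  · simpa using H.degree_le_maxDegree _

theorem isOddCycle_of_hasCopy [Fintype V] [DecidableRel H.Adj] (hH : H.Connected)
    (hΔ : H.maxDegree = 2) {n : ℕ} (hn : Odd n) (h3 : 3 ≤ n) (hc : HasCopy (cycleGraph n) H) :
    IsOddCycle H := by
  classical
  obtain ⟨f, hf⟩ := hc
  obtain ⟨m, rfl⟩ : ∃ m, n = m + 3 := ⟨n - 3, by omega⟩
  refine ⟨m + 3, hn, h3, nonempty_iso_of_degree_le hH f hf fun x => ?_⟩
  rw [cycleGraph_degree_three_le, ← hΔ]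
  exact H.degree_le_maxDegree _

end Free

/-- **Theorem 3 (family version).**  Let `k ≥ 1` and, for each `i : Fin k`, let
`𝒢 i` be a nonempty family (indexed by `ι i`) of connected finite simple graphs, with
minimum degree `d i = min {δ(G) : G ∈ 𝒢 i} ≥ 1`.  Let `H` be a connected finite simple
graph with `Δ(H) = d 0 + ⋯ + d (k-1)`.  Assume (i) if `k = 1` then `H` is not
isomorphic to any member of `𝒢 0`; (ii) if `K_{d i + 1} ∈ 𝒢 i` for every `i`, then
`H ≇ K_{Δ(H)+1}`; (iii) if `K₂ ∈ 𝒢 i` for every `i`, then `H` is neither an odd cycle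
nor a complete graph.  Then `V(H)` can be partitioned into sets `V 0, …, V (k-1)`
(the colour classes of a map `c : V → Fin k`) such that `H[V i]` is `𝒢 i`-free for
every `i`, and the class of colour `0` is a maximum `𝒢 0`-free subset of `V(H)`. -/
theorem family_free_partition_with_maximum_class
    {k : ℕ} (hk : 1 ≤ k)
    {ι : Fin k → Type*} [∀ i, Nonempty (ι i)]
    {β : ∀ i, ι i → Type*} [∀ i j, Fintype (β i j)]
    (𝒢 : ∀ i, (j : ι i) → SimpleGraph (β i j)) [∀ i j, DecidableRel (𝒢 i j).Adj]
    {V : Type*} [Fintype V]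
    (H : SimpleGraph V) [DecidableRel H.Adj]
    (hGconn : ∀ i j, (𝒢 i j).Connected)
    (hd : ∀ i, 1 ≤ ⨅ j, (𝒢 i j).minDegree)
    (hHconn : H.Connected)
    (hΔ : H.maxDegree = ∑ i, ⨅ j, (𝒢 i j).minDegree)
    (h1 : k = 1 → ∀ i j, ¬ Nonempty (H ≃g 𝒢 i j))
    (h2 : (∀ i, ∃ j, Nonempty
        (𝒢 i j ≃g (⊤ : SimpleGraph (Fin ((⨅ j', (𝒢 i j').minDegree) + 1))))) →
      ¬ Nonempty (H ≃g (⊤ : SimpleGraph (Fin (H.maxDegree + 1)))))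
    (h3 : (∀ i, ∃ j, Nonempty (𝒢 i j ≃g (⊤ : SimpleGraph (Fin 2)))) →
      ¬ IsOddCycle H ∧ ¬ ∃ n : ℕ, Nonempty (H ≃g (⊤ : SimpleGraph (Fin n)))) :
    ∃ c : V → Fin k,
      (∀ i : Fin k, ∀ j : ι i, ¬ HasCopy (𝒢 i j) (H.induce {v | c v = i})) ∧
      (∀ T : Set V, (∀ j : ι ⟨0, hk⟩, ¬ HasCopy (𝒢 ⟨0, hk⟩ j) (H.induce T)) →
        T.ncard ≤ {v | c v = ⟨0, hk⟩}.ncard) := by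
  classical
  let d : Fin k → ℕ := fun i => ⨅ j, (𝒢 i j).minDegree
  let P : Fin k → Finset V → Prop := fun i W => FreeOn (𝒢 i) H (W : Set V)
  let i₀ : Fin k := ⟨0, hk⟩
  have hP : ∀ i, SparseProperty H (d i) (P i) := fun i => sparseProperty_freeOn (hGconn i)
  have hsum : d i₀ + ∑ i ∈ Finset.univ.erase i₀, d i = H.maxDegree := by
    rw [hΔ, Finset.add_sum_erase _ _ (Finset.mem_univ i₀)]
  have hpart : ∃ A B, P i₀ A ∧ SplitsOn P (Finset.univ.erase i₀) B ∧ Disjoint A B ∧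
      A ∪ B = Finset.univ ∧ ∀ T, P i₀ T → T.card ≤ A.card := by
    have := Nonempty.intro i₀
    have hsplit := sparseProperty_splitsOn hP (Finset.univ.erase i₀)
    by_cases hk1 : k = 1
    · subst hk1
      refine ⟨Finset.univ, ∅, fun j hj => ?_, hsplit.empty, by simp, by simp,
        fun T _ => Finset.card_le_univ T⟩
      obtain ⟨f, hf, -⟩ := hasCopy_induce_iff.1 hj
      have := (hGconn i₀ j).nonempty
      refine h1 rfl i₀ j (nonempty_iso_of_degree_le hHconn f hf fun x => ?_)
      refine (H.degree_le_maxDegree _).trans (le_trans ?_ ((𝒢 i₀ j).minDegree_le_degree x))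
      rw [hΔ, Fin.sum_univ_one]
      exact ciInf_le (OrderBot.bddBelow _) j
    let Q : Bool → Finset V → Prop := fun b =>
      if b then SplitsOn P (Finset.univ.erase i₀) else P i₀
    let e : Bool → ℕ := fun b => if b then ∑ i ∈ Finset.univ.erase i₀, d i else d i₀
    have hQ : ∀ b, SparseProperty H (e b) (Q b) := by
      rintro (_ | _)
      exacts [hP i₀, hsplit]
    have hmem : ∀ {i}, i ≠ i₀ → i ∈ Finset.univ.erase i₀ := fun h => by simp [h]
    have hle : ∀ {i}, i ≠ i₀ → d i ≤ e true := fun h =>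
      Finset.single_le_sum (f := d) (fun _ _ => Nat.zero_le _) (hmem h)
    have he : ∀ b, 1 ≤ e b := by
      rintro (_ | _)
      · exact hd i₀
      · have h : (⟨1, by omega⟩ : Fin k) ≠ i₀ := by simp [i₀]
        exact (hd _).trans (hle h)
    have hdeg : ∀ T v, (nbrsIn H T v).card ≤ e false + e true := by
      intro T v
      refine le_trans ?_ ((H.degree_le_maxDegree v).trans hsum.ge)
      rw [← card_neighborFinset_eq_degree]
      refine Finset.card_le_card fun w hw => ?_
      rw [mem_neighborFinset]
      exact (mem_nbrsIn.1 hw).2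
    refine (exists_partition_or_clique_or_cycle hQ he hdeg).resolve_right ?_
    rintro ⟨hK, hrest⟩
    have hcomplete : ∀ i, ∃ j, Nonempty (𝒢 i j ≃g (⊤ : SimpleGraph (Fin (d i + 1)))) := by
      intro i
      obtain ⟨A, hA, hAP⟩ : ∃ A : Finset V, A.card = d i + 1 ∧ ¬ P i A := by
        by_cases hi : i = i₀
        · obtain ⟨K, hKQ, hKc⟩ := hK false
          exact ⟨K, hi ▸ hKc, hi ▸ hKQ⟩
        · obtain ⟨K, hKQ, hKc⟩ := hK true
          exact exists_not_of_not_splitsOn hP hKQ hKc (hmem hi)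
      exact exists_iso_top_of_not_freeOn rfl (hGconn i) hAP hA
    rcases hrest with ⟨K, hKc, hK⟩ | ⟨he1, n, hn, hn3, hc⟩
    · exact h2 hcomplete (nonempty_iso_top_of_isClique hHconn hK (hKc.trans (by rw [← hsum]; rfl)))
    · have hd1 : ∀ i, d i = 1 := by
        intro i
        by_cases hi : i = i₀
        · exact hi ▸ he1 false
        · exact le_antisymm ((hle hi).trans (he1 true).le) (hd i)
      have hΔ2 : H.maxDegree = 2 := by
        rw [← hsum]
        exact congrArg₂ (· + ·) (he1 false) (he1 true)
      refine (h3 fun i => ?_).1 (isOddCycle_of_hasCopy hHconn hΔ2 hn hn3 hc)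
      have := hcomplete i
      rwa [hd1 i] at this
  obtain ⟨A, B, hA, hB, hAB, huniv, hmax⟩ := hpart
  obtain ⟨c', hc', hcP⟩ := hB
  obtain ⟨c, hcA, hcB⟩ := exists_eqOn_eqOn hAB (fun _ => i₀) c'
  have hclass : {v | c v = i₀} = (A : Set V) := by
    ext v
    rw [Set.mem_ofPred_eq, Finset.mem_coe]
    refine ⟨fun hv => ?_, fun hv => hcA v hv⟩
    refine (Finset.mem_union.1 (huniv ▸ Finset.mem_univ v)).resolve_right fun hvB => ?_
    exact Finset.ne_of_mem_erase (hc' v hvB) (hcB v hvB ▸ hv)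
  refine ⟨c, fun i => ?_, fun T hT => ?_⟩
  · change FreeOn (𝒢 i) H {v | c v = i}
    by_cases hi : i = i₀
    · subst hi
      exact hclass ▸ hA
    · refine FreeOn.mono (fun v hv => ?_) (hcP i (by simp [hi]))
      rw [Finset.mem_coe, Finset.mem_filter]
      rcases Finset.mem_union.1 (huniv ▸ Finset.mem_univ v : v ∈ A ∪ B) with hvA | hvB
      · exact absurd ((hcA v hvA).symm.trans hv).symm hi
      · exact ⟨hvB, hcB v hvB ▸ hv⟩
  · rw [show {v | c v = ⟨0, hk⟩} = (A : Set V) from hclass, Set.ncard_coe_finset,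
      Set.ncard_eq_toFinset_card']
    refine hmax _ ?_
    change FreeOn (𝒢 i₀) H (T.toFinset : Set V)
    rw [Set.coe_toFinset]
    exact hT
end

section
/- Let H be a connected finite simple graph that is neither an odd cycle nor a complete graph, with maximum degree Δ(H) ≥ 1. Then V(H) can be partitioned into Δ(H) independent sets (i.e., H has a proper Δ(H)-coloring) such that one of the color classes is a maximum independent set of H. -/
open SimpleGraph

namespace SimpleGraph

variable {V α : Type*} {G : SimpleGraph V}

/-- `c` is a partial proper colouring of `G`; `none` marks the uncoloured vertices. -/
def IsPartialColoring (G : SimpleGraph V) (c : V → Option α) : Prop :=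
  ∀ ⦃u w a⦄, G.Adj u w → c u = some a → c w ≠ some a

/-- A partial proper colouring whose colour class `a₀` is a maximum independent set and which,
subject to that, has as few uncoloured vertices as possible. -/
structure IsExtremalColoring (G : SimpleGraph V) (a₀ : α) (c : V → Option α) : Prop where
  proper : G.IsPartialColoring c
  max_indep : ∀ T : Set V, (∀ a ∈ T, ∀ b ∈ T, ¬ G.Adj a b) → T.ncard ≤ {v | c v = some a₀}.ncard
  min_none : ∀ d : V → Option α, G.IsPartialColoring d →
    {v | d v = some a₀}.ncard = {v | c v = some a₀}.ncard →
    {v | c v = none}.ncard ≤ {v | d v = none}.ncard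

theorem IsPartialColoring.indep {c : V → Option α} (h : G.IsPartialColoring c) (a : α) :
    ∀ u ∈ {v | c v = some a}, ∀ w ∈ {v | c v = some a}, ¬ G.Adj u w :=
  fun _ hu _ hw hadj => h hadj hu hw

theorem exists_isExtremalColoring [Finite V] (G : SimpleGraph V) (a₀ : α) :
    ∃ c, G.IsExtremalColoring a₀ c := by
  classical
  obtain ⟨S, hS, hmax⟩ :=
    (Set.toFinite {T : Set V | ∀ a ∈ T, ∀ b ∈ T, ¬ G.Adj a b}).exists_maximalFor
      Set.ncard _ ⟨∅, by simp⟩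
  have hne : {c : V → Option α | G.IsPartialColoring c ∧
      {v | c v = some a₀}.ncard = S.ncard}.Nonempty := by
    refine ⟨fun v => if v ∈ S then some a₀ else none, ?_, ?_⟩
    · intro u w a hadj hu hw
      by_cases h1 : u ∈ S <;> by_cases h2 : w ∈ S <;> simp_all
    · congr 1; ext v; simp
  obtain ⟨c, ⟨hc, hcS⟩, hmin⟩ := exists_minimalFor_of_wellFoundedLT
    (fun c : V → Option α => c ∈ {c : V → Option α | G.IsPartialColoring c ∧
      {v | c v = some a₀}.ncard = S.ncard})
    (fun c => {v | c v = none}.ncard) hne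
  refine ⟨c, hc, fun T hT => ?_, fun d hd hdc => ?_⟩
  · rw [hcS]
    rcases le_total T.ncard S.ncard with h | h
    · exact h
    · exact hmax hT h
  · rcases le_total {v | c v = none}.ncard {v | d v = none}.ncard with h | h
    · exact h
    · exact hmin ⟨hd, hdc.trans hcS⟩ h

namespace IsExtremalColoring

variable {a₀ : α} {c : V → Option α}

theorem congr (h : G.IsExtremalColoring a₀ c) {d : V → Option α} (hd : G.IsPartialColoring d)
    (h0 : {v | d v = some a₀}.ncard = {v | c v = some a₀}.ncard)
    (hn : {v | d v = none}.ncard = {v | c v = none}.ncard) : G.IsExtremalColoring a₀ d :=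
  ⟨hd, fun T hT => h0 ▸ h.max_indep T hT, fun e he he0 => hn ▸ h.min_none e he (he0.trans h0)⟩

theorem exists_adj_eq_some [Finite V] (h : G.IsExtremalColoring a₀ c) {v : V} (hv : c v = none)
    (a : α) : ∃ w, G.Adj v w ∧ c w = some a := by
  classical
  by_contra! hno
  have hd : G.IsPartialColoring (Function.update c v (some a)) := by
    intro u w b hadj hu hw
    by_cases h1 : u = v
    · subst h1
      have h2 : w ≠ u := hadj.ne'
      simp_all
    · by_cases h2 : w = v
      · subst h2
        have := hno u hadj.symm
        simp_all
      · simp only [Function.update_of_ne h1, Function.update_of_ne h2] at hu hw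
        exact h.proper hadj hu hw
  by_cases ha : a = a₀
  · subst ha
    have hlt := h.max_indep _ (hd.indep a)
    have : {u | c u = some a} ⊂ {u | Function.update c v (some a) u = some a} := by
      refine ⟨fun u hu => ?_, fun hsub => ?_⟩
      · by_cases h1 : u = v <;> simp_all
      · have : v ∈ {u | c u = some a} := hsub (by simp)
        simp_all
    exact absurd (Set.ncard_lt_ncard this (Set.toFinite _)) (not_lt.2 hlt)
  · have h0 : {u | Function.update c v (some a) u = some a₀} = {u | c u = some a₀} := by
      ext u
      by_cases h1 : u = v <;> simp_all
    have hle := h.min_none _ hd (by rw [h0])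
    have : {u | Function.update c v (some a) u = none} ⊂ {u | c u = none} := by
      refine ⟨fun u hu => ?_, fun hsub => ?_⟩
      · by_cases h1 : u = v <;> simp_all
      · have : v ∈ {u | Function.update c v (some a) u = none} := hsub hv
        simp_all
    exact absurd (Set.ncard_lt_ncard this (Set.toFinite _)) (not_lt.2 hle)

section

variable [Fintype V] [DecidableRel G.Adj] [Fintype α]

theorem exists_colored_nbrs (hdeg : ∀ v, G.degree v ≤ Fintype.card α)
    (h : G.IsExtremalColoring a₀ c) {v : V} (hv : c v = none) :
    ∃ g : α → V, Function.Injective g ∧ (∀ a, G.Adj v (g a) ∧ c (g a) = some a) ∧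
      ∀ w, G.Adj v w → ∃ a, w = g a := by
  classical
  choose g hg using h.exists_adj_eq_some hv
  have hinj : Function.Injective g := fun a b hab => by
    have := (hg a).2
    rw [hab, (hg b).2] at this
    exact (Option.some_injective _ this).symm
  refine ⟨g, hinj, hg, fun w hw => ?_⟩
  have hsub : Finset.univ.image g ⊆ G.neighborFinset v := by
    intro u hu
    obtain ⟨a, -, rfl⟩ := Finset.mem_image.1 hu
    simpa using (hg a).1
  have heq := Finset.eq_of_subset_of_card_le hsub (by
    rw [Finset.card_image_of_injective _ hinj, Finset.card_univ]
    exact hdeg v)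
  have : w ∈ Finset.univ.image g := by rw [heq]; simpa using hw
  obtain ⟨a, -, ha⟩ := Finset.mem_image.1 this
  exact ⟨a, ha.symm⟩

theorem degree_eq (hdeg : ∀ v, G.degree v ≤ Fintype.card α)
    (h : G.IsExtremalColoring a₀ c) {v : V} (hv : c v = none) :
    G.degree v = Fintype.card α := by
  classical
  obtain ⟨g, hg, hadj, hall⟩ := h.exists_colored_nbrs hdeg hv
  rw [← Finset.card_univ, ← Finset.card_image_of_injective _ hg, ← card_neighborFinset_eq_degree]
  congr 1
  ext w
  simp only [mem_neighborFinset, Finset.mem_image, Finset.mem_univ, true_and]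
  exact ⟨fun hw => (hall w hw).imp fun _ => Eq.symm, fun ⟨a, ha⟩ => ha ▸ (hadj a).1⟩

theorem ne_none_of_adj (hdeg : ∀ v, G.degree v ≤ Fintype.card α)
    (h : G.IsExtremalColoring a₀ c) {v w : V} (hv : c v = none) (hw : G.Adj v w) :
    c w ≠ none := by
  obtain ⟨g, -, hadj, hall⟩ := h.exists_colored_nbrs hdeg hv
  obtain ⟨a, rfl⟩ := hall w hw
  simp [(hadj a).2]

theorem eq_of_adj_of_adj (hdeg : ∀ v, G.degree v ≤ Fintype.card α)
    (h : G.IsExtremalColoring a₀ c) {v w w' : V} (hv : c v = none) (hw : G.Adj v w)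
    (hw' : G.Adj v w') (heq : c w = c w') : w = w' := by
  obtain ⟨g, -, hadj, hall⟩ := h.exists_colored_nbrs hdeg hv
  obtain ⟨a, rfl⟩ := hall w hw
  obtain ⟨b, rfl⟩ := hall w' hw'
  rw [(hadj a).2, (hadj b).2] at heq
  rw [Option.some_injective _ heq]

theorem comp_swap [DecidableEq V] (hdeg : ∀ v, G.degree v ≤ Fintype.card α)
    (h : G.IsExtremalColoring a₀ c) {v w : V} (hv : c v = none) (hw : G.Adj v w) :
    G.IsExtremalColoring a₀ (c ∘ Equiv.swap v w) := by
  have hcard : ∀ o, {u | (c ∘ Equiv.swap v w) u = o}.ncard = {u | c u = o}.ncard := fun o =>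
    Set.ncard_preimage_of_injective_subset_range (s := {u | c u = o})
      (Equiv.swap v w).injective (by simp)
  refine h.congr ?_ (hcard _) (hcard _)
  have key : ∀ u a, u ≠ v → u ≠ w → G.Adj v u → c w = some a → c u ≠ some a := by
    intro u a huv huw hadj h1 h2
    exact huw (h.eq_of_adj_of_adj hdeg hv hadj hw (by rw [h1, h2]))
  intro u u' a hadj hu hu'
  simp only [Function.comp_apply] at hu hu'
  have hne := hadj.ne
  rcases eq_or_ne u v with rfl | h1
  · rw [Equiv.swap_apply_left] at hu
    rcases eq_or_ne u' w with rfl | h2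
    · simp_all
    · rw [Equiv.swap_apply_of_ne_of_ne hne.symm h2] at hu'
      exact key u' a hne.symm h2 hadj hu hu'
  · rcases eq_or_ne u' v with rfl | h2
    · rw [Equiv.swap_apply_left] at hu'
      rcases eq_or_ne u w with rfl | h3
      · simp_all
      · rw [Equiv.swap_apply_of_ne_of_ne h1 h3] at hu
        exact key u a h1 h3 hadj.symm hu' hu
    · rcases eq_or_ne u w with rfl | h3
      · simp_all
      rcases eq_or_ne u' w with rfl | h4
      · simp_all
      rw [Equiv.swap_apply_of_ne_of_ne h1 h3] at hu
      rw [Equiv.swap_apply_of_ne_of_ne h2 h4] at hu'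
      exact h.proper hadj hu hu'

end

end IsExtremalColoring

/-- `u` and `w` are adjacent vertices with colours in `{i, j}`. -/
def KempeAdj (G : SimpleGraph V) (i j : α) (c : V → Option α) (u w : V) : Prop :=
  G.Adj u w ∧ (c u = some i ∨ c u = some j) ∧ (c w = some i ∨ c w = some j)

theorem KempeAdj.symm {i j : α} {c : V → Option α} {u w : V} (h : G.KempeAdj i j c u w) :
    G.KempeAdj i j c w u :=
  ⟨h.1.symm, h.2.2, h.2.1⟩

open Classical in
/-- Interchange the colours `i` and `j` on the Kempe chain through `x`. -/
noncomputable def kempeSwap (G : SimpleGraph V) (i j : α) (c : V → Option α)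
    (x : V) : V → Option α := fun u =>
  if Relation.ReflTransGen (G.KempeAdj i j c) x u then
    if c u = some i then some j else some i
  else c u

section TokenReach

variable [DecidableEq V]

/-- States `(d, u)` obtained from `(c, v)` by repeatedly moving the uncoloured vertex to an
adjacent vertex of colour `i` or `j`, which passes its colour back. -/
inductive TokenReach (G : SimpleGraph V) (i j : α) (c : V → Option α) (v : V) :
    (V → Option α) → V → Prop
  | refl : TokenReach G i j c v c v
  | step {d : V → Option α} {u w : V} : TokenReach G i j c v d u → G.Adj u w →
      (d w = some i ∨ d w = some j) → TokenReach G i j c v (d ∘ Equiv.swap u w) w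

/-- The uncoloured vertex of `c` at `v` can be moved to `u` along colours `i` and `j`. -/
def IsVisitable (G : SimpleGraph V) (i j : α) (c : V → Option α) (v u : V) : Prop :=
  ∃ d, TokenReach G i j c v d u

variable [Fintype V] [DecidableRel G.Adj] [Fintype α] {a₀ : α} {c : V → Option α} {v : V}
  {i j l : α}

theorem IsExtremalColoring.tokenReach (hdeg : ∀ v, G.degree v ≤ Fintype.card α)
    (h : G.IsExtremalColoring a₀ c) (hv : c v = none) {d : V → Option α} {u : V}
    (hr : G.TokenReach i j c v d u) :
    G.IsExtremalColoring a₀ d ∧ d u = none ∧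
      (∀ l, l ≠ i → l ≠ j → ∀ z, d z = some l ↔ c z = some l) ∧
      ∀ z, (d z = some i ∨ d z = some j ∨ z = u) ↔ (c z = some i ∨ c z = some j ∨ z = v) := by
  induction hr with
  | refl => exact ⟨h, hv, by simp, by simp⟩
  | @step d u w _ hadj hw ih =>
    obtain ⟨h1, h2, h3, h4⟩ := ih
    have hne := hadj.ne
    refine ⟨h1.comp_swap hdeg h2 hadj, by simp [h2], fun l hi hj z => ?_, fun z => ?_⟩
    · rw [← h3 l hi hj]
      simp only [Function.comp_apply, Equiv.swap_apply_def]
      split_ifs <;> grind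
    · rw [← h4]
      simp only [Function.comp_apply, Equiv.swap_apply_def]
      split_ifs <;> grind

namespace IsVisitable

theorem eq_of_adj_of_adj (hdeg : ∀ v, G.degree v ≤ Fintype.card α)
    (h : G.IsExtremalColoring a₀ c) (hv : c v = none) {u w w' : V} (hu : G.IsVisitable i j c v u)
    (hi : l ≠ i) (hj : l ≠ j) (hw : G.Adj u w) (hw' : G.Adj u w') (hl : c w = some l)
    (hl' : c w' = some l) : w = w' := by
  obtain ⟨d, hd⟩ := hu
  obtain ⟨h1, h2, h3, -⟩ := h.tokenReach hdeg hv hd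
  exact h1.eq_of_adj_of_adj hdeg h2 hw hw' (by rw [(h3 l hi hj _).2 hl, (h3 l hi hj _).2 hl'])

theorem exists_pair (hdeg : ∀ v, G.degree v ≤ Fintype.card α)
    (h : G.IsExtremalColoring a₀ c) (hv : c v = none) {u : V} (hu : G.IsVisitable i j c v u)
    (hij : i ≠ j) : ∃ p q, p ≠ q ∧ ∀ w,
      (G.Adj u w ∧ (c w = some i ∨ c w = some j ∨ w = v)) ↔ (w = p ∨ w = q) := by
  obtain ⟨d, hd⟩ := hu
  obtain ⟨h1, h2, -, h4⟩ := h.tokenReach hdeg hv hd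
  obtain ⟨p, hp, hpi⟩ := h1.exists_adj_eq_some h2 i
  obtain ⟨q, hq, hqj⟩ := h1.exists_adj_eq_some h2 j
  refine ⟨p, q, by rintro rfl; simp_all, fun w => ⟨fun ⟨hw, hD⟩ => ?_, ?_⟩⟩
  · rw [← h4] at hD
    rcases hD with hD | hD | rfl
    · exact Or.inl (h1.eq_of_adj_of_adj hdeg h2 hw hp (by rw [hD, hpi]))
    · exact Or.inr (h1.eq_of_adj_of_adj hdeg h2 hw hq (by rw [hD, hqj]))
    · exact absurd hw (G.loopless.irrefl _)
  · rintro (rfl | rfl)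
    · exact ⟨hp, (h4 _).1 (Or.inl hpi)⟩
    · exact ⟨hq, (h4 _).1 (Or.inr (Or.inl hqj))⟩

theorem of_adj (hdeg : ∀ v, G.degree v ≤ Fintype.card α)
    (h : G.IsExtremalColoring a₀ c) (hv : c v = none) {u w : V} (hu : G.IsVisitable i j c v u)
    (hw : G.Adj u w) (hD : c w = some i ∨ c w = some j ∨ w = v) : G.IsVisitable i j c v w := by
  obtain ⟨d, hd⟩ := hu
  obtain ⟨-, -, -, h4⟩ := h.tokenReach hdeg hv hd
  rcases (h4 w).2 hD with h5 | h5 | rfl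
  · exact ⟨_, hd.step hw (Or.inl h5)⟩
  · exact ⟨_, hd.step hw (Or.inr h5)⟩
  · exact absurd hw (G.loopless.irrefl _)

theorem of_reflTransGen (hdeg : ∀ v, G.degree v ≤ Fintype.card α)
    (h : G.IsExtremalColoring a₀ c) (hv : c v = none) {u w : V} (hu : G.IsVisitable i j c v u)
    (hw : Relation.ReflTransGen (G.KempeAdj i j c) u w) : G.IsVisitable i j c v w := by
  induction hw with
  | refl => exact hu
  | tail _ hbc ih => exact ih.of_adj hdeg h hv hbc.1 (by have := hbc.2.2; tauto)

theorem adj_of_two (hdeg : ∀ v, G.degree v ≤ Fintype.card α)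
    (h : G.IsExtremalColoring a₀ c) (hv : c v = none) {u : V} (hu : G.IsVisitable i j c v u)
    (hu' : G.IsVisitable i l c v u) (hij : i ≠ j) (hjl : j ≠ l) (hc : c u = some i) :
    G.Adj v u := by
  by_contra hadj
  obtain ⟨p, q, hpq, hD⟩ := hu.exists_pair hdeg h hv hij
  have key : ∀ w, (w = p ∨ w = q) → G.Adj u w ∧ c w = some j := by
    intro w hw
    obtain ⟨h1, h2 | h2 | rfl⟩ := (hD w).2 hw
    · exact absurd h2 (h.proper h1 hc)
    · exact ⟨h1, h2⟩
    · exact absurd h1.symm hadj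
  exact hpq (hu'.eq_of_adj_of_adj hdeg h hv hij.symm hjl (key p (Or.inl rfl)).1
    (key q (Or.inr rfl)).1 (key p (Or.inl rfl)).2 (key q (Or.inr rfl)).2)

end IsVisitable

namespace IsExtremalColoring

open Classical in
/-- The number of `i`-coloured and `j`-coloured vertices in the Kempe chain of a neighbour of an
uncoloured vertex agree, and the chain ends in another neighbour of that vertex. -/
theorem kempe_chain (hdeg : ∀ v, G.degree v ≤ Fintype.card α) (h : G.IsExtremalColoring a₀ c)
    (hv : c v = none) (hij : i ≠ j) {x y : V} (hx : G.Adj v x) (hxi : c x = some i)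
    (hy : G.Adj v y) (hyj : c y = some j) :
    Relation.ReflTransGen (G.KempeAdj i j c) x y ∧
      (Finset.univ.filter fun u => Relation.ReflTransGen (G.KempeAdj i j c) x u ∧
        c u = some i).card =
      (Finset.univ.filter fun u => Relation.ReflTransGen (G.KempeAdj i j c) x u ∧
        c u = some j).card := by
  set K : V → Prop := Relation.ReflTransGen (G.KempeAdj i j c) x with hK
  have hxK : K x := Relation.ReflTransGen.refl
  have hvis : ∀ u, K u → G.IsVisitable i j c v u := fun u hu =>
    (IsVisitable.of_adj hdeg h hv ⟨c, .refl⟩ hx (Or.inl hxi)).of_reflTransGen hdeg h hv hu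
  have hstep : ∀ u w, K u → (c u = some i ∨ c u = some j) → G.Adj u w →
      (c w = some i ∨ c w = some j) → K w := fun u w hu hcu hadj hcw => hu.tail ⟨hadj, hcu, hcw⟩
  have count : ∀ a b, ((a = i ∧ b = j) ∨ (a = j ∧ b = i)) → ∀ u, K u → c u = some a →
      ((Finset.univ.filter fun w => K w ∧ c w = some b).filter fun w => G.Adj u w).card +
        (if G.Adj v u then 1 else 0) = 2 := by
    intro a b hab u hu hcu
    obtain ⟨p, q, hpq, hD⟩ := (hvis u hu).exists_pair hdeg h hv hij
    have hset : ((Finset.univ.filter fun w => K w ∧ c w = some b).filter fun w => G.Adj u w) =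
        ({p, q} : Finset V).erase v := by
      ext w
      simp only [Finset.mem_filter, Finset.mem_univ, true_and, Finset.mem_erase,
        Finset.mem_insert, Finset.mem_singleton, ← hD]
      constructor
      · rintro ⟨⟨-, h1⟩, h2⟩
        refine ⟨by rintro rfl; simp_all, h2, ?_⟩
        rcases hab with ⟨rfl, rfl⟩ | ⟨rfl, rfl⟩ <;> simp [h1]
      · rintro ⟨h1, h2, h3⟩
        have h4 := h.proper h2 hcu
        have h5 : c w = some i ∨ c w = some j := by tauto
        refine ⟨⟨hstep u w hu ?_ h2 h5, ?_⟩, h2⟩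
        · rcases hab with ⟨rfl, rfl⟩ | ⟨rfl, rfl⟩ <;> simp [hcu]
        · rcases hab with ⟨rfl, rfl⟩ | ⟨rfl, rfl⟩ <;> tauto
    rw [hset]
    have hvD := hD v
    split_ifs with hvu
    · have hmem : v ∈ ({p, q} : Finset V) := by
        simpa using hvD.1 ⟨hvu.symm, Or.inr (Or.inr rfl)⟩
      rw [Finset.card_erase_of_mem hmem, Finset.card_pair hpq]
    · have hmem : v ∉ ({p, q} : Finset V) := by
        intro hm
        exact hvu (hvD.2 (by simpa using hm)).1.symm
      rw [Finset.erase_eq_of_notMem hmem, Finset.card_pair hpq]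
  set I := Finset.univ.filter fun u => K u ∧ c u = some i with hI
  set J := Finset.univ.filter fun u => K u ∧ c u = some j with hJ
  have sumI : ∑ u ∈ I, (J.filter fun w => G.Adj u w).card + (I.filter fun u => G.Adj v u).card
      = I.card * 2 := by
    rw [Finset.card_filter, ← Finset.sum_add_distrib, Finset.sum_const_nat]
    intro u hu
    simp only [hI, Finset.mem_filter, Finset.mem_univ, true_and] at hu
    exact count i j (Or.inl ⟨rfl, rfl⟩) u hu.1 hu.2
  have sumJ : ∑ u ∈ J, (I.filter fun w => G.Adj u w).card + (J.filter fun u => G.Adj v u).card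
      = J.card * 2 := by
    rw [Finset.card_filter, ← Finset.sum_add_distrib, Finset.sum_const_nat]
    intro u hu
    simp only [hJ, Finset.mem_filter, Finset.mem_univ, true_and] at hu
    exact count j i (Or.inr ⟨rfl, rfl⟩) u hu.1 hu.2
  have hsum : ∑ u ∈ I, (J.filter fun w => G.Adj u w).card =
      ∑ u ∈ J, (I.filter fun w => G.Adj u w).card := by
    have := Finset.sum_card_bipartiteAbove_eq_sum_card_bipartiteBelow (s := I) (t := J) G.Adj
    simpa only [Finset.bipartiteAbove, Finset.bipartiteBelow, G.adj_comm] using this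
  have hI1 : (I.filter fun u => G.Adj v u) = {x} := by
    ext u
    simp only [hI, Finset.mem_filter, Finset.mem_univ, true_and, Finset.mem_singleton]
    constructor
    · rintro ⟨⟨-, h1⟩, h2⟩
      exact h.eq_of_adj_of_adj hdeg hv h2 hx (by rw [h1, hxi])
    · rintro rfl
      exact ⟨⟨hxK, hxi⟩, hx⟩
  have hJ1 : (J.filter fun u => G.Adj v u) ⊆ {y} := by
    intro u
    simp only [hJ, Finset.mem_filter, Finset.mem_univ, true_and, Finset.mem_singleton]
    rintro ⟨⟨-, h1⟩, h2⟩
    exact h.eq_of_adj_of_adj hdeg hv h2 hy (by rw [h1, hyj])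
  have hJc := Finset.card_le_card hJ1
  rw [hI1, Finset.card_singleton] at sumI
  rw [Finset.card_singleton] at hJc
  have hJc1 : (J.filter fun u => G.Adj v u).card = 1 := by omega
  refine ⟨?_, by omega⟩
  have : y ∈ J.filter fun u => G.Adj v u := by
    rw [Finset.eq_of_subset_of_card_le hJ1 (by simp [hJc1])]
    simp
  simp only [hJ, Finset.mem_filter, Finset.mem_univ, true_and] at this
  exact this.1.1

theorem kempeSwap (hdeg : ∀ v, G.degree v ≤ Fintype.card α) (h : G.IsExtremalColoring a₀ c)
    (hv : c v = none) (hij : i ≠ j) {x y : V} (hx : G.Adj v x) (hxi : c x = some i)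
    (hy : G.Adj v y) (hyj : c y = some j) : G.IsExtremalColoring a₀ (G.kempeSwap i j c x) := by
  classical
  obtain ⟨-, hcard⟩ := h.kempe_chain hdeg hv hij hx hxi hy hyj
  set K : V → Prop := Relation.ReflTransGen (G.KempeAdj i j c) x with hK
  have hKc : ∀ u, K u → (c u = some i ∨ c u = some j) := by
    intro u hu
    cases hu with
    | refl => exact Or.inl hxi
    | tail _ h1 => exact h1.2.2
  have hstep : ∀ u w, K u → G.Adj u w → (c w = some i ∨ c w = some j) → K w :=
    fun u w hu hadj hcw => hu.tail ⟨hadj, hKc u hu, hcw⟩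
  set d := G.kempeSwap i j c x with hd
  have hd1 : ∀ u, K u → c u = some i → d u = some j := fun u hu hc => by
    simp only [hd, SimpleGraph.kempeSwap]
    rw [if_pos hu, if_pos hc]
  have hd2 : ∀ u, K u → c u = some j → d u = some i := fun u hu hc => by
    simp only [hd, SimpleGraph.kempeSwap]
    rw [if_pos hu, if_neg (by rw [hc]; simpa using hij.symm)]
  have hd3 : ∀ u, ¬ K u → d u = c u := fun u hu => by
    simp only [hd, SimpleGraph.kempeSwap]
    rw [if_neg hu]
  clear_value d
  have hncard : ∀ o, {u | d u = o}.ncard = {u | c u = o}.ncard := by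
    intro o
    rw [Set.ncard_eq_toFinset_card', Set.ncard_eq_toFinset_card', Set.toFinset_ofPred,
      Set.toFinset_ofPred, ← Finset.card_filter_add_card_filter_not K,
      ← Finset.card_filter_add_card_filter_not (s := Finset.univ.filter fun u => c u = o) K]
    simp only [Finset.filter_filter]
    have e1 : (Finset.univ.filter fun u => d u = o ∧ ¬ K u) =
        Finset.univ.filter fun u => c u = o ∧ ¬ K u := by
      ext u; simp only [Finset.mem_filter, Finset.mem_univ, true_and]; grind
    have e2 : (Finset.univ.filter fun u => d u = o ∧ K u).card =
        (Finset.univ.filter fun u => c u = o ∧ K u).card := by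
      by_cases hoi : o = some i
      · have f1 : (Finset.univ.filter fun u => d u = o ∧ K u) =
          Finset.univ.filter fun u => K u ∧ c u = some j := by
          ext u; simp only [Finset.mem_filter, Finset.mem_univ, true_and]; grind
        have f2 : (Finset.univ.filter fun u => c u = o ∧ K u) =
          Finset.univ.filter fun u => K u ∧ c u = some i := by
          ext u; simp only [Finset.mem_filter, Finset.mem_univ, true_and]; grind
        rw [f1, f2, hcard]
      · by_cases hoj : o = some j
        · have f1 : (Finset.univ.filter fun u => d u = o ∧ K u) =
            Finset.univ.filter fun u => K u ∧ c u = some i := by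
            ext u; simp only [Finset.mem_filter, Finset.mem_univ, true_and]; grind
          have f2 : (Finset.univ.filter fun u => c u = o ∧ K u) =
            Finset.univ.filter fun u => K u ∧ c u = some j := by
            ext u; simp only [Finset.mem_filter, Finset.mem_univ, true_and]; grind
          rw [f1, f2, hcard]
        · congr 1
          ext u; simp only [Finset.mem_filter, Finset.mem_univ, true_and]; grind
    rw [e1, e2]
  refine h.congr ?_ (hncard _) (hncard _)
  intro u w a hadj hu hw
  have p1 := @h.proper u w i hadj
  have p2 := @h.proper u w j hadj
  have p3 := @h.proper u w a hadj
  have s1 := hstep u w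
  have s2 := hstep w u
  have k1 := hKc u
  have k2 := hKc w
  have := hadj.symm
  grind

theorem adj_of_adj_of_adj (hdeg : ∀ v, G.degree v ≤ Fintype.card α)
    (h : G.IsExtremalColoring a₀ c) (hv : c v = none) (hcard : 3 ≤ Fintype.card α) {x y : V}
    (hx : G.Adj v x) (hy : G.Adj v y) (hxy : x ≠ y) : G.Adj x y := by
  classical
  obtain ⟨i, hxi⟩ := Option.ne_none_iff_exists'.1 (h.ne_none_of_adj hdeg hv hx)
  obtain ⟨j, hyj⟩ := Option.ne_none_iff_exists'.1 (h.ne_none_of_adj hdeg hv hy)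
  have hij : i ≠ j := by
    rintro rfl
    exact hxy (h.eq_of_adj_of_adj hdeg hv hx hy (by rw [hxi, hyj]))
  obtain ⟨l, hl⟩ : ∃ l, l ∉ ({i, j} : Finset α) := by
    by_contra! hall
    have := Finset.card_le_card (fun a _ => hall a : Finset.univ ⊆ ({i, j} : Finset α))
    rw [Finset.card_univ, Finset.card_pair hij] at this
    omega
  simp only [Finset.mem_insert, Finset.mem_singleton, not_or] at hl
  obtain ⟨hli, hlj⟩ : l ≠ i ∧ l ≠ j := hl
  obtain ⟨z, hz, hzl⟩ := h.exists_adj_eq_some hv l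
  have h1 := h.comp_swap hdeg hv hx
  have h1x : (c ∘ Equiv.swap v x) x = none := by simp [hv]
  have h1v : (c ∘ Equiv.swap v x) v = some i := by simp [hxi]
  have h1o : ∀ u, u ≠ v → u ≠ x → (c ∘ Equiv.swap v x) u = c u := fun u hu hu' => by
    simp [Equiv.swap_apply_of_ne_of_ne hu hu']
  obtain ⟨w, hw, h1w⟩ := h1.exists_adj_eq_some h1x j
  have hwx : w ≠ x := hw.ne'
  have hwv : w ≠ v := by rintro rfl; rw [h1v] at h1w; exact hij (Option.some_injective _ h1w)
  have hwj : c w = some j := by rw [← h1o w hwv hwx, h1w]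
  by_contra hnadj
  have hwy : w ≠ y := by rintro rfl; exact hnadj hw
  have h2 := h.kempeSwap hdeg hv hli.symm hx hxi hz hzl
  have hK : ∀ u, Relation.ReflTransGen (G.KempeAdj i l c) x u → c u = some i ∨ c u = some l := by
    intro u hu
    cases hu with
    | refl => exact Or.inl hxi
    | tail _ h1 => exact h1.2.2
  have h2o : ∀ u, ¬ Relation.ReflTransGen (G.KempeAdj i l c) x u →
      G.kempeSwap i l c x u = c u := fun u hu => by
    simp only [SimpleGraph.kempeSwap]
    rw [if_neg hu]
  have h2x : G.kempeSwap i l c x x = some l := by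
    simp only [SimpleGraph.kempeSwap]
    rw [if_pos .refl, if_pos hxi]
  have h2v : G.kempeSwap i l c x v = none := by
    rw [h2o v (fun hu => by simpa [hv] using hK v hu), hv]
  have h2j : ∀ u, c u = some j → G.kempeSwap i l c x u = some j := fun u hu => by
    rw [h2o u (fun hu' => by have := hK u hu'; rw [hu] at this; simp at this; tauto), hu]
  have hvx : G.IsVisitable i j c v x := IsVisitable.of_adj hdeg h hv ⟨c, .refl⟩ hx (Or.inl hxi)
  have hvx' : G.IsVisitable i l c v x := IsVisitable.of_adj hdeg h hv ⟨c, .refl⟩ hx (Or.inl hxi)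
  have h2vis : ∀ u, G.IsVisitable i j c v u → u ≠ x → (c u = some i ∨ c u = some j) →
      G.kempeSwap i l c x u = c u := by
    rintro u hu hux (hc | hc)
    · refine h2o u fun hu' => hux ?_
      have := hu.adj_of_two hdeg h hv (hvx'.of_reflTransGen hdeg h hv hu') hij hlj.symm hc
      exact h.eq_of_adj_of_adj hdeg hv this hx (by rw [hc, hxi])
    · rw [h2j u hc, hc]
  have hchain := (h1.kempe_chain hdeg h1x hij.symm hw h1w hx.symm h1v).1
  have hmain : ∀ u, Relation.ReflTransGen (G.KempeAdj j i (c ∘ Equiv.swap v x)) w u →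
      Relation.ReflTransGen (G.KempeAdj j i (G.kempeSwap i l c x)) w y ∨
      (u ≠ v ∧ u ≠ x ∧ G.IsVisitable i j c v u ∧
        Relation.ReflTransGen (G.KempeAdj j i (G.kempeSwap i l c x)) w u) := by
    intro u hu
    induction hu with
    | refl => exact Or.inr ⟨hwv, hwx, hvx.of_adj hdeg h hv hw (by tauto), .refl⟩
    | @tail u u' _ hs ih =>
      obtain ⟨hs1, hs2, hs3⟩ := hs
      rcases ih with ih | ⟨huv, hux, hvis, hr⟩
      · exact Or.inl ih
      rw [h1o u huv hux] at hs2
      by_cases hu'v : u' = v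
      · subst hu'v
        rcases hs2 with hs2 | hs2
        · rw [← h.eq_of_adj_of_adj hdeg hv hs1.symm hy (by rw [hs2, hyj])]
          exact Or.inl hr
        · exact absurd (h.eq_of_adj_of_adj hdeg hv hs1.symm hx (by rw [hs2, hxi])) hux
      · have hu'x : u' ≠ x := by rintro rfl; rw [h1x] at hs3; simp at hs3
        rw [h1o u' hu'v hu'x] at hs3
        have hvis' := hvis.of_adj hdeg h hv hs1 (by tauto)
        refine Or.inr ⟨hu'v, hu'x, hvis', hr.tail ⟨hs1, ?_, ?_⟩⟩
        · rwa [h2vis u hvis hux hs2.symm]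
        · rwa [h2vis u' hvis' hu'x hs3.symm]
  have hwy' : Relation.ReflTransGen (G.KempeAdj j i (G.kempeSwap i l c x)) y w := by
    rcases hmain v hchain with hm | hm
    · have : Std.Symm (G.KempeAdj j i (G.kempeSwap i l c x)) := ⟨fun _ _ => KempeAdj.symm⟩
      exact Relation.ReflTransGen.stdSymm.symm _ _ hm
    · exact absurd rfl hm.1
  have v1 : G.IsVisitable j i (G.kempeSwap i l c x) v w :=
    (IsVisitable.of_adj hdeg h2 h2v ⟨_, .refl⟩ hy (Or.inl (h2j y hyj))).of_reflTransGen
      hdeg h2 h2v hwy'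
  have v2 : G.IsVisitable j l (G.kempeSwap i l c x) v w :=
    (IsVisitable.of_adj hdeg h2 h2v ⟨_, .refl⟩ hx (Or.inr (Or.inl h2x))).of_adj
      hdeg h2 h2v hw (Or.inl (h2j w hwj))
  have := v1.adj_of_two hdeg h2 h2v v2 hij.symm hli.symm (h2j w hwj)
  exact hwy (h.eq_of_adj_of_adj hdeg hv this hy (by rw [hwj, hyj]))

theorem eq_top (hdeg : ∀ v, G.degree v ≤ Fintype.card α) (h : G.IsExtremalColoring a₀ c)
    (hv : c v = none) (hcard : Fintype.card α ≠ 2) (hconn : G.Connected) : G = ⊤ := by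
  classical
  have hclique : ∀ x y, G.Adj v x → G.Adj v y → x ≠ y → G.Adj x y := by
    intro x y hx hy hxy
    by_cases h3 : 3 ≤ Fintype.card α
    · exact h.adj_of_adj_of_adj hdeg hv h3 hx hy hxy
    · have h1 := h.degree_eq hdeg hv
      rw [← card_neighborFinset_eq_degree] at h1
      exact absurd (Finset.card_le_one.1 (by omega : (G.neighborFinset v).card ≤ 1) x
        (by simpa using hx) y (by simpa using hy)) hxy
  have hclosed : ∀ u w, G.Adj v u → G.Adj u w → w = v ∨ G.Adj v w := by
    intro u w hu hw
    have hsub : insert v ((G.neighborFinset v).erase u) ⊆ G.neighborFinset u := by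
      intro t
      simp only [Finset.mem_insert, Finset.mem_erase, mem_neighborFinset]
      rintro (rfl | ⟨h1, h2⟩)
      · exact hu.symm
      · exact hclique u t hu h2 h1.symm
    have heq := Finset.eq_of_subset_of_card_le hsub (by
      rw [Finset.card_insert_of_notMem (by simp), Finset.card_erase_of_mem (by simpa using hu),
        card_neighborFinset_eq_degree, card_neighborFinset_eq_degree, h.degree_eq hdeg hv]
      have := hdeg u
      omega)
    have : w ∈ insert v ((G.neighborFinset v).erase u) := by rw [heq]; simpa using hw
    simp only [Finset.mem_insert, Finset.mem_erase, mem_neighborFinset] at this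
    tauto
  have hall : ∀ u, u = v ∨ G.Adj v u := by
    intro u
    have hr := (reachable_iff_reflTransGen v u).1 (hconn.preconnected v u)
    induction hr with
    | refl => exact Or.inl rfl
    | tail _ hs ih =>
      rcases ih with rfl | ih
      · exact Or.inr hs
      · exact hclosed _ _ ih hs
  ext a b
  rw [top_adj]
  refine ⟨fun hab => hab.ne, fun hab => ?_⟩
  rcases hall a with rfl | ha <;> rcases hall b with rfl | hb
  · exact absurd rfl hab
  · exact hb
  · exact ha.symm
  · exact hclique a b ha hb hab

theorem degree_eq_of_connected (hdeg : ∀ v, G.degree v ≤ Fintype.card α)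
    (h : G.IsExtremalColoring a₀ c) (hv : c v = none) (hcard : Fintype.card α = 2)
    (hconn : G.Connected) : (∀ u, G.degree u = 2) ∧ Odd (Fintype.card V) := by
  classical
  obtain ⟨i, j, hij, huniv⟩ := Finset.card_eq_two.1 (Finset.card_univ.trans hcard)
  have hcol : ∀ a : α, a = i ∨ a = j := fun a => by
    have := Finset.mem_univ a
    rw [huniv] at this
    simpa using this
  have hcol' : ∀ (d : V → Option α) (u : V), d u ≠ none → d u = some i ∨ d u = some j := by
    intro d u hu
    obtain ⟨a, ha⟩ := Option.ne_none_iff_exists'.1 hu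
    rcases hcol a with rfl | rfl <;> simp [ha]
  have hvis : ∀ u, G.IsVisitable i j c v u := by
    intro u
    have hr := (reachable_iff_reflTransGen v u).1 (hconn.preconnected v u)
    induction hr with
    | refl => exact ⟨c, .refl⟩
    | tail _ hs ih =>
      obtain ⟨d, hd⟩ := ih
      obtain ⟨h1, h2, -⟩ := h.tokenReach hdeg hv hd
      exact ⟨_, hd.step hs (hcol' d _ (h1.ne_none_of_adj hdeg h2 hs))⟩
  have hnone : ∀ u, u ≠ v → c u = some i ∨ c u = some j := by
    intro u hu
    obtain ⟨d, hd⟩ := hvis u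
    have := ((h.tokenReach hdeg hv hd).2.2.2 u).1 (by tauto)
    tauto
  refine ⟨fun u => ?_, ?_⟩
  · obtain ⟨d, hd⟩ := hvis u
    obtain ⟨h1, h2, -⟩ := h.tokenReach hdeg hv hd
    rw [h1.degree_eq hdeg h2, hcard]
  obtain ⟨x, hx, hxi⟩ := h.exists_adj_eq_some hv i
  obtain ⟨y, hy, hyj⟩ := h.exists_adj_eq_some hv j
  obtain ⟨hxy, hbal⟩ := h.kempe_chain hdeg hv hij hx hxi hy hyj
  have hK : ∀ u, u = v ∨ Relation.ReflTransGen (G.KempeAdj i j c) x u := by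
    intro u
    have hr := (reachable_iff_reflTransGen v u).1 (hconn.preconnected v u)
    induction hr with
    | refl => exact Or.inl rfl
    | @tail u w _ hs ih =>
      by_cases hwv : w = v
      · exact Or.inl hwv
      rcases eq_or_ne u v with rfl | huv
      · rcases hnone w hwv with hw | hw
        · rw [h.eq_of_adj_of_adj hdeg hv hs hx (by rw [hw, hxi])]
          exact Or.inr .refl
        · rw [h.eq_of_adj_of_adj hdeg hv hs hy (by rw [hw, hyj])]
          exact Or.inr hxy
      · exact Or.inr ((ih.resolve_left huv).tail ⟨hs, hnone u huv, hnone w hwv⟩)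
  set K : V → Prop := Relation.ReflTransGen (G.KempeAdj i j c) x
  have hunion : (Finset.univ : Finset V) = insert v ((Finset.univ.filter fun u => K u ∧
      c u = some i) ∪ Finset.univ.filter fun u => K u ∧ c u = some j) := by
    ext u
    simp only [Finset.mem_univ, Finset.mem_insert, Finset.mem_union, Finset.mem_filter, true_and,
      true_iff]
    have h1 := hK u
    have h2 := hnone u
    tauto
  have hdisj : Disjoint (Finset.univ.filter fun u => K u ∧ c u = some i)
      (Finset.univ.filter fun u => K u ∧ c u = some j) := by
    rw [Finset.disjoint_filter]
    rintro u - ⟨-, h1⟩ ⟨-, h2⟩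
    rw [h1] at h2
    exact hij (Option.some_injective _ h2)
  rw [← Finset.card_univ, hunion, Finset.card_insert_of_notMem (by simp [hv]),
    Finset.card_union_of_disjoint hdisj, ← hbal]
  exact ⟨_, by ring⟩

end IsExtremalColoring

end TokenReach

/-- A finite connected `2`-regular graph is a cycle. -/
theorem Connected.nonempty_iso_cycleGraph [Fintype V] [DecidableRel G.Adj] (hconn : G.Connected)
    (hdeg : ∀ v, G.degree v = 2) :
    3 ≤ Fintype.card V ∧ Nonempty (G ≃g cycleGraph (Fintype.card V)) := by
  classical
  have hcyc : ¬ G.IsAcyclic := by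
    intro hac
    have : Nontrivial V := by
      obtain ⟨v⟩ := hconn.nonempty
      obtain ⟨w, hw⟩ := (G.degree_pos_iff_exists_adj v).1 (by rw [hdeg]; norm_num)
      exact ⟨v, w, hw.ne⟩
    obtain ⟨v, hv⟩ := IsTree.exists_vert_degree_one_of_nontrivial ⟨hconn, hac⟩
    rw [hdeg] at hv
    omega
  rw [isAcyclic_iff_free_cycleGraph] at hcyc
  simp only [SimpleGraph.Free, not_forall, not_not] at hcyc
  obtain ⟨n, hn, ⟨f⟩⟩ := hcyc
  obtain ⟨m, rfl⟩ : ∃ m, n = m + 3 := ⟨n - 3, by omega⟩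
  have hinj : Function.Injective f := f.injective
  have hnbr : ∀ a, (G.neighborFinset (f a)) = ((cycleGraph (m + 3)).neighborFinset a).image f := by
    intro a
    symm
    refine Finset.eq_of_subset_of_card_le ?_ ?_
    · intro u hu
      obtain ⟨b, hb, rfl⟩ := Finset.mem_image.1 hu
      rw [mem_neighborFinset] at hb ⊢
      exact f.toHom.map_adj hb
    · rw [Finset.card_image_of_injective _ hinj, card_neighborFinset_eq_degree,
        card_neighborFinset_eq_degree, cycleGraph_degree_three_le, hdeg]
  have hnbr' : ∀ a u, G.Adj (f a) u → ∃ b, (cycleGraph (m + 3)).Adj a b ∧ f b = u := by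
    intro a u hu
    have : u ∈ G.neighborFinset (f a) := by simpa using hu
    rw [hnbr] at this
    simpa using this
  have hsurj : Function.Surjective f := by
    intro u
    have hr := (reachable_iff_reflTransGen (f 0) u).1 (hconn.preconnected (f 0) u)
    induction hr with
    | refl => exact ⟨0, rfl⟩
    | tail _ hs ih =>
      obtain ⟨a, rfl⟩ := ih
      obtain ⟨b, -, hb⟩ := hnbr' a _ hs
      exact ⟨b, hb⟩
  have e : cycleGraph (m + 3) ≃g G :=
    ⟨Equiv.ofBijective f ⟨hinj, hsurj⟩, by
      intro a b
      refine ⟨fun hab => ?_, fun hab => f.toHom.map_adj hab⟩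
      obtain ⟨b', hb', hbb⟩ := hnbr' a _ hab
      rwa [← hinj hbb]⟩
  have hcard : Fintype.card V = m + 3 := by
    rw [← Fintype.card_congr e.toEquiv, Fintype.card_fin]
  rw [hcard]
  exact ⟨by omega, ⟨e.symm⟩⟩

end SimpleGraph

/-- **Catlin's theorem.**  If `H` is a connected finite simple graph with `Δ(H) ≥ 1`
that is neither an odd cycle nor a complete graph, then `H` has a proper
`Δ(H)`-coloring one of whose colour classes is a maximum independent set of `H`. -/
theorem catlin_brooks_coloring_with_maximum_independent_class
    {V : Type*} [Fintype V] (H : SimpleGraph V) [DecidableRel H.Adj]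
    (hconn : H.Connected) (hΔ : 1 ≤ H.maxDegree)
    (hodd : ¬ IsOddCycle H) (hcomplete : H ≠ ⊤) :
    ∃ c : V → Fin H.maxDegree,
      (∀ v w : V, H.Adj v w → c v ≠ c w) ∧
      ∃ i : Fin H.maxDegree, ∀ T : Set V,
        (∀ a ∈ T, ∀ b ∈ T, ¬ H.Adj a b) → T.ncard ≤ {v | c v = i}.ncard := by
  have : Nonempty (Fin H.maxDegree) := ⟨⟨0, hΔ⟩⟩
  classical
  obtain ⟨a₀⟩ := this
  obtain ⟨c, hc⟩ := H.exists_isExtremalColoring a₀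
  have hdeg : ∀ v, H.degree v ≤ Fintype.card (Fin H.maxDegree) := fun v => by
    rw [Fintype.card_fin]
    exact H.degree_le_maxDegree v
  have hsome : ∀ v, c v ≠ none := by
    intro v hv
    by_cases h2 : Fintype.card (Fin H.maxDegree) = 2
    · obtain ⟨hreg, hoddcard⟩ := hc.degree_eq_of_connected hdeg hv h2 hconn
      obtain ⟨h3, hiso⟩ := hconn.nonempty_iso_cycleGraph hreg
      exact hodd ⟨_, hoddcard, h3, hiso⟩
    · exact hcomplete (hc.eq_top hdeg hv h2 hconn)
  choose g hg using fun v => Option.ne_none_iff_exists'.1 (hsome v)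
  refine ⟨g, fun v w hadj heq => hc.proper hadj (hg v) (by rw [hg w, heq]), a₀, fun T hT => ?_⟩
  have := hc.max_indep T hT
  simpa [hg] using this
end
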